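/- arXiv:0705.0723 — 2 statements merged into one kernel-verified Lean document; each statement's English description precedes it below -/
import Mathlib

section
/- Beurling's approximation: with K(z) = (sin πz)²/(πz)² and H(z) = ((sin πz)/π)²(∑_{n∈ℤ} sgn(n)/(z−n)² + 2/z), one has H(x) − K(x) ≤ sgn(x) ≤ H(x) + K(x) for all real x, and ∫_{−∞}^{∞} |H(x) ± K(x) − sgn(x)| dx = 1. -/
open Real MeasureTheory
open scoped Classical

/-- Fejér kernel `K(x) = (sin πx)²/(πx)²`. -/
noncomputable def beurlingK (x : ℝ) : ℝ := (Real.sin (π * x)) ^ 2 / (π * x) ^ 2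

/-- Beurling's function `H(x) = ((sin πx)/π)² (∑_{n ∈ ℤ} sgn(n)/(x−n)² + 2/x)`.
(At integer points the series formula has a removable singularity; we use the value of the
analytic continuation there, which equals `sgn(x)`.) -/
noncomputable def beurlingH (x : ℝ) : ℝ :=
  if ∃ n : ℤ, (n : ℝ) = x then Real.sign x
  else (Real.sin (π * x) / π) ^ 2 *
    ((∑' n : ℤ, Real.sign n / (x - n) ^ 2) + 2 / x)


lemma coeff_norm (x : ℝ) (hx : ¬ ∃ n : ℤ, (n : ℝ) = x) (n : ℤ) :
    ‖fourierCoeffOn (zero_lt_one' ℝ) (fun t : ℝ => Complex.exp (2 * π * Complex.I * x * t)) n‖ ^ 2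
      = (Real.sin (π * x) / π) ^ 2 * (1 / (x - n) ^ 2) := by
  have hne : x - n ≠ 0 := fun h => hx ⟨n, by linarith⟩
  have hneC : (x : ℂ) - n ≠ 0 := by exact_mod_cast hne
  have hpi : (π : ℂ) ≠ 0 := by exact_mod_cast Real.pi_ne_zero
  rw [fourierCoeffOn_eq_integral]
  have h1 : ∀ t : ℝ, fourier (-n) (t : AddCircle ((1:ℝ) - 0)) •
      Complex.exp (2 * π * Complex.I * x * t)
      = Complex.exp ((2 * π * Complex.I * (x - n)) * t) := by
    intro t
    rw [fourier_coe_apply, smul_eq_mul, ← Complex.exp_add]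
    congr 1
    push_cast
    simp
    ring
  simp_rw [h1]
  have hc : (2 * π * Complex.I * (x - n) : ℂ) ≠ 0 := by
    simp [hneC, hpi]
  rw [integral_exp_mul_complex hc]
  have h2 : Complex.exp (2 * π * Complex.I * (x - n) * (1:ℝ)) =
      Complex.exp (Complex.I * ((2 * π * x : ℝ) : ℂ)) := by
    rw [Complex.exp_eq_exp_iff_exists_int]
    exact ⟨-n, by push_cast; ring⟩
  rw [h2]
  simp only [Complex.ofReal_zero, mul_zero, Complex.exp_zero, sub_zero, div_one, one_smul]
  rw [norm_div, Complex.norm_exp_I_mul_ofReal_sub_one, div_pow]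
  have h3 : ‖(2 * π * Complex.I * (x - n) : ℂ)‖ = |2 * π * (x - n)| := by
    have : (2 * π * Complex.I * (x - n) : ℂ) = ((2 * π * (x - n) : ℝ) : ℂ) * Complex.I := by
      push_cast; ring
    rw [this, norm_mul, Complex.norm_I, mul_one, Complex.norm_real, Real.norm_eq_abs]
  rw [h3, Real.norm_eq_abs, sq_abs, sq_abs, show 2 * π * x / 2 = π * x by ring]
  field_simp

lemma hasSum_one (x : ℝ) (hx : ¬ ∃ n : ℤ, (n : ℝ) = x) :
    HasSum (fun n : ℤ => (Real.sin (π * x) / π) ^ 2 * (1 / (x - n) ^ 2)) 1 := by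
  have hc : Continuous (fun t : ℝ => Complex.exp (2 * π * Complex.I * x * t)) := by fun_prop
  have hnorm : ∀ t : ℝ, ‖Complex.exp (2 * π * Complex.I * x * t)‖ = 1 := by
    intro t
    rw [show (2 * π * Complex.I * x * t : ℂ) = ((2 * π * x * t : ℝ) : ℂ) * Complex.I by
      push_cast; ring, Complex.norm_exp_ofReal_mul_I]
  have h := hasSum_sq_fourierCoeffOn (f := fun t : ℝ => Complex.exp (2 * π * Complex.I * x * t))
    (zero_lt_one' ℝ)
    (MemLp.of_bound hc.aestronglyMeasurable 1 (Filter.Eventually.of_forall fun t => (hnorm t).le))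
  simp_rw [coeff_norm x hx, hnorm] at h
  simpa using h

lemma sin_ne (x : ℝ) (hx : ¬ ∃ n : ℤ, (n : ℝ) = x) : Real.sin (π * x) ≠ 0 := by
  rw [Ne, Real.sin_eq_zero_iff]
  rintro ⟨n, hn⟩
  exact hx ⟨n, by have := Real.pi_ne_zero; rw [mul_comm] at hn; exact mul_left_cancel₀ this hn⟩

lemma hasSum_inv (x : ℝ) (hx : ¬ ∃ n : ℤ, (n : ℝ) = x) :
    HasSum (fun n : ℤ => (1 / (x - n) ^ 2)) (((Real.sin (π * x) / π) ^ 2)⁻¹) := by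
  have h0 : (Real.sin (π * x) / π) ^ 2 ≠ 0 :=
    pow_ne_zero _ (div_ne_zero (sin_ne x hx) Real.pi_ne_zero)
  have := (hasSum_one x hx).mul_left (((Real.sin (π * x) / π) ^ 2)⁻¹)
  simpa [← mul_assoc, inv_mul_cancel₀ h0] using this

lemma summable_S (x : ℝ) (hx : ¬ ∃ n : ℤ, (n : ℝ) = x) :
    Summable (fun k : ℕ => 1 / (x + (k + 1)) ^ 2) := by
  have h := (hasSum_inv x hx).summable.comp_injective
    (i := fun k : ℕ => (-((k : ℤ) + 1))) (by intro a b h; simpa using h)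
  refine h.congr fun k => ?_
  simp only [Function.comp]
  push_cast
  ring_nf

lemma H_formula (x : ℝ) (hx : ¬ ∃ n : ℤ, (n : ℝ) = x) :
    beurlingH x = 1 + (Real.sin (π * x) / π) ^ 2 *
      (2 / x - 1 / x ^ 2 - 2 * ∑' k : ℕ, 1 / (x + (k + 1)) ^ 2) := by
  have h0 : (Real.sin (π * x) / π) ^ 2 ≠ 0 :=
    pow_ne_zero _ (div_ne_zero (sin_ne x hx) Real.pi_ne_zero)
  have hd : HasSum (fun n : ℤ => (Real.sign n - 1) * (1 / (x - n) ^ 2))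
      (-(1 / x ^ 2) + (-2) * ∑' k : ℕ, 1 / (x + (k + 1)) ^ 2) := by
    apply HasSum.of_nat_of_neg_add_one
    · convert hasSum_single (f := fun n : ℕ =>
        (Real.sign ((n : ℤ) : ℝ) - 1) * (1 / (x - ((n : ℤ) : ℝ)) ^ 2)) 0 ?_ using 1
      · simp
      · intro n hn
        have : (0:ℝ) < n := by exact_mod_cast Nat.pos_of_ne_zero hn
        simp [Real.sign_of_pos this]
    · refine HasSum.congr_fun ((summable_S x hx).hasSum.mul_left (-2)) fun k => ?_
      have : (((-((k : ℤ) + 1) : ℤ)) : ℝ) < 0 := by push_cast; linarith [k.cast_nonneg (α := ℝ)]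
      rw [Real.sign_of_neg this]
      push_cast
      ring
  have hs := hd.add (hasSum_inv x hx)
  have h2 : (fun n : ℤ => Real.sign n / (x - n) ^ 2) =
      fun n : ℤ => (Real.sign n - 1) * (1 / (x - n) ^ 2) + 1 / (x - n) ^ 2 := by
    funext n; ring
  rw [beurlingH, if_neg hx, h2, hs.tsum_eq]
  set S := ∑' k : ℕ, 1 / (x + (k + 1)) ^ 2
  set c := (Real.sin (π * x) / π) ^ 2
  have h3 : c * c⁻¹ = 1 := mul_inv_cancel₀ h0
  linear_combination h3

lemma hasSum_tele (x : ℝ) (hx : 0 < x) :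
    HasSum (fun k : ℕ => 1 / (x + k) - 1 / (x + (k + 1))) (1 / x) := by
  rw [hasSum_iff_tendsto_nat_of_nonneg]
  · have h : ∀ n : ℕ, ∑ k ∈ Finset.range n, (1 / (x + k) - 1 / (x + (k + 1)))
        = 1 / x - 1 / (x + n) := by
      intro n
      have := Finset.sum_range_sub' (fun k : ℕ => 1 / (x + k)) n
      simpa using this
    simp_rw [h]
    have : Filter.Tendsto (fun n : ℕ => 1 / (x + n)) Filter.atTop (nhds 0) :=
      (tendsto_const_nhds).div_atTop
        (Filter.tendsto_atTop_add_const_left _ _ tendsto_natCast_atTop_atTop)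
    simpa using tendsto_const_nhds.sub this
  · intro k
    have : (0:ℝ) ≤ k := k.cast_nonneg
    exact sub_nonneg.2 (one_div_le_one_div_of_le (by linarith) (by linarith))

lemma S_le (x : ℝ) (hx : 0 < x) (hn : ¬ ∃ n : ℤ, (n : ℝ) = x) :
    ∑' k : ℕ, 1 / (x + (k + 1)) ^ 2 ≤ 1 / x := by
  rw [← (hasSum_tele x hx).tsum_eq]
  refine (summable_S x hn).tsum_le_tsum (fun k => ?_) (hasSum_tele x hx).summable
  have : (0:ℝ) ≤ k := k.cast_nonneg
  have h1 : 0 < x + k := by linarith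
  have h2 : 0 < x + (k + 1) := by linarith
  rw [div_sub_div _ _ h1.ne' h2.ne', div_le_div_iff₀ (by positivity) (by positivity)]
  nlinarith

lemma le_S (x : ℝ) (hx : 0 < x) (hn : ¬ ∃ n : ℤ, (n : ℝ) = x) :
    1 / x ≤ 1 / x ^ 2 + ∑' k : ℕ, 1 / (x + (k + 1)) ^ 2 := by
  have hs : Summable (fun k : ℕ => 1 / (x + k) ^ 2) := by
    rw [← summable_nat_add_iff 1]
    simpa using summable_S x hn
  have h := hs.tsum_eq_zero_add
  simp only [Nat.cast_add, Nat.cast_one, Nat.cast_zero, add_zero] at h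
  rw [← h, ← (hasSum_tele x hx).tsum_eq]
  refine (hasSum_tele x hx).summable.tsum_le_tsum (fun k => ?_) hs
  have : (0:ℝ) ≤ k := k.cast_nonneg
  have h1 : 0 < x + k := by linarith
  have h2 : 0 < x + (k + 1) := by linarith
  rw [div_sub_div _ _ h1.ne' h2.ne', div_le_div_iff₀ (by positivity) (by positivity)]
  nlinarith

lemma K_eq (x : ℝ) : beurlingK x = (Real.sin (π * x) / π) ^ 2 * (1 / x ^ 2) := by
  rw [beurlingK]; simp only [div_eq_mul_inv, mul_pow, mul_inv, inv_pow]; ring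

lemma K_nonneg (x : ℝ) : 0 ≤ beurlingK x := by unfold beurlingK; positivity

lemma K_neg (x : ℝ) : beurlingK (-x) = beurlingK x := by simp [beurlingK]

lemma H_neg (x : ℝ) : beurlingH (-x) = - beurlingH x := by
  by_cases hx : ∃ n : ℤ, (n : ℝ) = x
  · have hx' : ∃ n : ℤ, (n : ℝ) = -x := by
      obtain ⟨n, hn⟩ := hx; exact ⟨-n, by push_cast; rw [hn]⟩
    rw [beurlingH, beurlingH, if_pos hx, if_pos hx', Real.sign_neg]
  · have hx' : ¬ ∃ n : ℤ, (n : ℝ) = -x := by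
      rintro ⟨n, hn⟩; exact hx ⟨-n, by push_cast; rw [hn]; ring⟩
    rw [beurlingH, beurlingH, if_neg hx, if_neg hx']
    have : ∑' n : ℤ, Real.sign n / (-x - n) ^ 2 = - ∑' n : ℤ, Real.sign n / (x - n) ^ 2 := by
      rw [← (Equiv.neg ℤ).tsum_eq, ← tsum_neg]
      congr 1; funext n
      simp only [Equiv.neg_apply, Int.cast_neg, Real.sign_neg]
      ring
    rw [this]
    simp only [mul_neg, Real.sin_neg, neg_div, div_neg]
    ring

lemma ineq_pos (x : ℝ) (hx : 0 < x) : beurlingH x - beurlingK x ≤ Real.sign x ∧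
      Real.sign x ≤ beurlingH x + beurlingK x := by
  by_cases hn : ∃ n : ℤ, (n : ℝ) = x
  · have := K_nonneg x
    rw [beurlingH, if_pos hn]; constructor <;> linarith
  · rw [H_formula x hn, K_eq, Real.sign_of_pos hx]
    have h1 := S_le x hx hn
    have h2 := le_S x hx hn
    set S := ∑' k : ℕ, 1 / (x + (k + 1)) ^ 2
    have hc : 0 ≤ (Real.sin (π * x) / π) ^ 2 := sq_nonneg _
    have e : 2 / x = 2 * (1 / x) := by ring
    rw [e]
    constructor
    · nlinarith [mul_nonneg hc (sub_nonneg.2 h2)]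
    · nlinarith [mul_nonneg hc (sub_nonneg.2 h1)]

lemma ineq_all (x : ℝ) : beurlingH x - beurlingK x ≤ Real.sign x ∧
      Real.sign x ≤ beurlingH x + beurlingK x := by
  rcases lt_trichotomy x 0 with h | h | h
  · have := ineq_pos (-x) (by linarith)
    rw [H_neg, K_neg, Real.sign_neg] at this
    constructor <;> linarith [this.1, this.2]
  · have := K_nonneg x
    rw [beurlingH, if_pos ⟨0, by simp [h]⟩]; constructor <;> linarith
  · exact ineq_pos x h

lemma K_meas : Measurable beurlingK := by unfold beurlingK; fun_prop

lemma ae_nonint : ∀ᵐ x : ℝ, ¬ ∃ n : ℤ, (n : ℝ) = x :=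
  (Set.countable_range (fun n : ℤ => (n : ℝ))).ae_notMem volume

lemma H_meas : AEMeasurable beurlingH := by
  have hS : Measurable (fun x : ℝ => ∑' k : ℕ, 1 / (x + (k + 1)) ^ 2) := by
    have : (fun x : ℝ => ∑' k : ℕ, 1 / (x + (k + 1)) ^ 2) =
        fun x : ℝ => (∑' k : ℕ, ENNReal.ofReal (1 / (x + (k + 1)) ^ 2)).toReal := by
      funext x
      rw [ENNReal.tsum_toReal_eq (fun _ => ENNReal.ofReal_ne_top)]
      congr 1; funext k
      rw [ENNReal.toReal_ofReal (by positivity)]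
    rw [this]
    refine Measurable.ennreal_toReal (Measurable.tsum fun k => ?_)
    fun_prop
  refine ⟨fun x => 1 + (Real.sin (π * x) / π) ^ 2 *
      (2 / x - 1 / x ^ 2 - 2 * ∑' k : ℕ, 1 / (x + (k + 1)) ^ 2), ?_, ?_⟩
  · fun_prop
  · filter_upwards [ae_nonint] with x hx using H_formula x hx

lemma sign_meas : Measurable Real.sign := by
  unfold Real.sign
  exact Measurable.ite measurableSet_Iio measurable_const
    (Measurable.ite measurableSet_Ioi measurable_const measurable_const)

lemma lintegral_K : ∫⁻ x : ℝ, ENNReal.ofReal (beurlingK x) = 1 := by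
  have hK := K_meas
  rw [← setLIntegral_univ, ← iUnion_Ioc_intCast ℝ,
    lintegral_iUnion (fun _ => measurableSet_Ioc) (Set.pairwise_disjoint_Ioc_intCast ℝ)]
  have h1 : ∀ n : ℤ, ∫⁻ x in Set.Ioc (n : ℝ) (n + 1), ENNReal.ofReal (beurlingK x) =
      ∫⁻ x in Set.Ioc (0 : ℝ) 1, ENNReal.ofReal (beurlingK (x + n)) := by
    intro n
    rw [← (measurePreserving_add_right volume (n : ℝ)).setLIntegral_comp_preimage_emb
      (measurableEmbedding_addRight _)]
    simp
  simp_rw [h1]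
  rw [← lintegral_tsum (fun n => by fun_prop)]
  have h2 : ∀ᵐ x ∂(volume.restrict (Set.Ioc (0:ℝ) 1)),
      ∑' n : ℤ, ENNReal.ofReal (beurlingK (x + n)) = 1 := by
    refine ae_restrict_of_ae ?_
    filter_upwards [ae_nonint] with x hx
    have h3 : HasSum (fun n : ℤ => beurlingK (x + n)) 1 := by
      rw [← (Equiv.neg ℤ).hasSum_iff]
      convert hasSum_one x hx using 2 with n
      simp only [Function.comp, Equiv.neg_apply]
      rw [K_eq, div_pow, div_pow]
      push_cast
      rw [← sub_eq_add_neg, mul_sub, mul_comm π (n : ℝ), Real.sin_sub_int_mul_pi, mul_pow,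
        ← sq_abs ((-1 : ℝ) ^ n), abs_neg_one_zpow]
      simp
    rw [← ENNReal.ofReal_tsum_of_nonneg (fun n => K_nonneg _) h3.summable, h3.tsum_eq,
      ENNReal.ofReal_one]
  rw [lintegral_congr_ae h2]
  simp

lemma K_integrable : Integrable beurlingK := by
  refine ⟨K_meas.aestronglyMeasurable, ?_⟩
  rw [hasFiniteIntegral_iff_ofReal (Filter.Eventually.of_forall K_nonneg), lintegral_K]
  exact ENNReal.one_lt_top

lemma integral_K : ∫ x : ℝ, beurlingK x = 1 := by
  rw [integral_eq_lintegral_of_nonneg_ae (Filter.Eventually.of_forall K_nonneg)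
    K_meas.aestronglyMeasurable, lintegral_K, ENNReal.toReal_one]

lemma integral_plus : ∫ x : ℝ, (beurlingH x + beurlingK x - Real.sign x) = 1 := by
  have hInt : Integrable (fun x : ℝ => beurlingH x + beurlingK x - Real.sign x) := by
    refine (K_integrable.const_mul 2).mono'
      ((H_meas.add K_meas.aemeasurable).sub sign_meas.aemeasurable).aestronglyMeasurable
      (Filter.Eventually.of_forall fun x => ?_)
    have := ineq_all x
    rw [Real.norm_eq_abs, abs_of_nonneg (by linarith [this.2])]
    linarith [this.1]
  have h1 := integral_neg_eq_self (fun x : ℝ => beurlingH x + beurlingK x - Real.sign x) volume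
  have h2 := integral_add hInt hInt.comp_neg
  have h3 : ∀ x : ℝ, (beurlingH x + beurlingK x - Real.sign x) +
      (beurlingH (-x) + beurlingK (-x) - Real.sign (-x)) = 2 * beurlingK x := by
    intro x; rw [H_neg, K_neg, Real.sign_neg]; ring
  simp_rw [h3] at h2
  rw [integral_const_mul, integral_K, h1] at h2
  linarith


/-- **Beurling's approximation to the sign function**:
`H(x) − K(x) ≤ sgn(x) ≤ H(x) + K(x)` for all real `x`, and
`∫ |H ± K − sgn| = 1`. -/
theorem beurling_approximation_sgn :
    (∀ x : ℝ, beurlingH x - beurlingK x ≤ Real.sign x ∧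
      Real.sign x ≤ beurlingH x + beurlingK x) ∧
    (∫ x : ℝ, |beurlingH x + beurlingK x - Real.sign x|) = 1 ∧
    (∫ x : ℝ, |beurlingH x - beurlingK x - Real.sign x|) = 1 := by
  refine ⟨ineq_all, ?_, ?_⟩
  · rw [← integral_plus]
    congr 1; funext x
    rw [abs_of_nonneg (by linarith [(ineq_all x).2])]
  · rw [← integral_plus,
      ← integral_neg_eq_self (fun x : ℝ => beurlingH x + beurlingK x - Real.sign x) volume]
    congr 1; funext x
    rw [abs_of_nonpos (by linarith [(ineq_all x).1]), H_neg, K_neg, Real.sign_neg]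
    ring
end

section
/- Assume RH. Then |1/ζ(1/2 + 1/log x + it)| ≪ (|t| + 2)^{log log x} for large x, and consequently the integral of x^s/(s ζ(s)) along the vertical segment from 1/2 + 1/log x − i x₀ to 1/2 + 1/log x + i x₀, with x₀ = [exp(√(log x))], is ≪ x^{1/2} exp((log x)^{1/2} log log x). -/
open Real Complex MeasureTheory intervalIntegral

namespace CVS

lemma harnack_ball {f : ℂ → ℂ} (hf : DifferentiableOn ℂ f (Metric.ball 0 1))
    (hpos : ∀ w ∈ Metric.ball (0:ℂ) 1, 0 ≤ (f w).re) {w : ℂ} (hw : ‖w‖ < 1) :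
    (f w).re ≤ (1 + ‖w‖) / (1 - ‖w‖) * (f 0).re := by
  have h1 : 0 < 1 - ‖w‖ := by linarith
  have key : ∀ ε > 0, (f w).re ≤ (1 + ‖w‖) / (1 - ‖w‖) * (f 0).re
      + ε * (2 * ‖w‖ / (1 - ‖w‖)) := by
    intro ε hε
    have h0 := hpos 0 (by simp)
    have hM : 0 < (f 0).re + ε := by linarith
    have := Complex.borelCaratheodory_zero (f := fun z => f 0 - f z) (R := 1) (z := w) hM
      (by fun_prop) (fun x hx => by
        have := hpos x hx
        simp only [Set.mem_ofPred_eq, sub_re]; linarith) one_pos (by simpa using hw) (by simp)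
    have h2 : -(f 0 - f w).re ≤ ‖f 0 - f w‖ := (neg_le_abs _).trans (abs_re_le_norm _)
    simp only [sub_re] at h2
    have h3 : (f w).re ≤ (f 0).re + 2 * ((f 0).re + ε) * ‖w‖ / (1 - ‖w‖) := by linarith
    refine h3.trans (le_of_eq ?_)
    field_simp; ring
  refine le_of_forall_pos_le_add fun ε hε => ?_
  have h2 : 0 ≤ 2 * ‖w‖ / (1 - ‖w‖) := by positivity
  have := key (ε / (2 * ‖w‖ / (1 - ‖w‖) + 1)) (by positivity)
  refine this.trans ?_
  gcongr
  rw [div_mul_eq_mul_div, div_le_iff₀ (by positivity)]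
  nlinarith

/-- the Moebius map from the unit disc to the right half plane with `0 ↦ c`. -/
noncomputable def mob (c w : ℂ) : ℂ := (c + (starRingEnd ℂ) c * w) / (1 - w)

lemma one_sub_ne {w : ℂ} (hw : ‖w‖ < 1) : (1 - w) ≠ 0 := by
  intro h
  have : w = 1 := by linear_combination -h
  rw [this] at hw; simp at hw

lemma mob_re_pos {c w : ℂ} (hc : 0 < c.re) (hw : ‖w‖ < 1) : 0 < (mob c w).re := by
  have h := one_sub_ne hw
  have hn : 0 < normSq (1 - w) := normSq_pos.mpr h
  have hw2 : normSq w < 1 := by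
    rw [normSq_eq_norm_sq]; nlinarith [norm_nonneg w]
  have : (mob c w).re = c.re * (1 - normSq w) / normSq (1 - w) := by
    unfold mob
    rw [div_re]
    rw [← add_div]
    congr 1
    simp [normSq_apply]; ring
  rw [this]
  have : 0 < 1 - normSq w := by linarith
  positivity

lemma mob_diff (c : ℂ) : DifferentiableOn ℂ (mob c) (Metric.ball 0 1) := by
  unfold mob
  refine DifferentiableOn.div (by fun_prop) (by fun_prop) ?_
  intro w hw
  exact one_sub_ne (by simpa using hw)

lemma mob_zero (c : ℂ) : mob c 0 = c := by simp [mob]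

lemma add_conj_ne {z c : ℂ} (hc : 0 < c.re) (hz : 0 < z.re) : z + (starRingEnd ℂ) c ≠ 0 := by
  intro h
  have := congrArg re h
  simp at this; linarith

lemma mob_inv {z c : ℂ} (hc : 0 < c.re) (hz : 0 < z.re) :
    mob c ((z - c) / (z + (starRingEnd ℂ) c)) = z := by
  have h := add_conj_ne hc hz
  have h2 : c + (starRingEnd ℂ) c ≠ 0 := add_conj_ne hc hc
  unfold mob
  have h3 : 1 - (z - c) / (z + (starRingEnd ℂ) c) = (c + (starRingEnd ℂ) c) / (z + (starRingEnd ℂ) c) := by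
    field_simp; ring
  rw [h3]
  field_simp; ring

lemma harnack_hp {f : ℂ → ℂ} (hf : DifferentiableOn ℂ f {z | 0 < z.re})
    (hpos : ∀ z : ℂ, 0 < z.re → 0 ≤ (f z).re) {c z : ℂ} (hc : 0 < c.re) (hz : 0 < z.re)
    {r : ℝ} (hr1 : r < 1) (h : ‖z - c‖ ≤ r * ‖z + (starRingEnd ℂ) c‖) :
    (f z).re ≤ (1 + r) / (1 - r) * (f c).re := by
  set w := (z - c) / (z + (starRingEnd ℂ) c) with hw
  have hne := add_conj_ne hc hz
  have hwr : ‖w‖ ≤ r := by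
    rw [hw, norm_div, div_le_iff₀ (norm_pos_iff.mpr hne)]; exact h
  have hw1 : ‖w‖ < 1 := by linarith
  have := harnack_ball (f := fun w => f (mob c w))
    (hf.comp (mob_diff c) (fun w hw => mob_re_pos hc (by simpa using hw)))
    (fun w hw => hpos _ (mob_re_pos hc (by simpa using hw))) hw1
  rw [mob_zero, hw, mob_inv hc hz, ← hw] at this
  refine this.trans ?_
  have := hpos c hc
  have : 0 < 1 - r := by linarith
  have : 0 ≤ 1 + r := by linarith [norm_nonneg w]
  gcongr

lemma harnack_log {q : ℂ → ℂ} (hq : DifferentiableOn ℂ q {z | 0 < z.re})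
    (hne : ∀ z : ℂ, 0 < z.re → q z ≠ 0) (hle : ∀ z : ℂ, 0 < z.re → ‖q z‖ ≤ 1)
    {c z : ℂ} (hc : 0 < c.re) (hz : 0 < z.re)
    {r : ℝ} (hr1 : r < 1) (h : ‖z - c‖ ≤ r * ‖z + (starRingEnd ℂ) c‖) :
    -Real.log ‖q z‖ ≤ (1 + r) / (1 - r) * (-Real.log ‖q c‖) := by
  set w := (z - c) / (z + (starRingEnd ℂ) c) with hw
  have hne' := add_conj_ne hc hz
  have hwr : ‖w‖ ≤ r := by
    rw [hw, norm_div, div_le_iff₀ (norm_pos_iff.mpr hne')]; exact h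
  have hw1 : ‖w‖ < 1 := by linarith
  set Q : ℂ → ℂ := fun w => q (mob c w) with hQ
  have hQd : DifferentiableOn ℂ Q (Metric.ball 0 1) :=
    hq.comp (mob_diff c) (fun w hw => mob_re_pos hc (by simpa using hw))
  have hQ0 : ∀ w ∈ Metric.ball (0:ℂ) 1, Q w ≠ 0 :=
    fun w hw => hne _ (mob_re_pos hc (by simpa using hw))
  have hlog : DifferentiableOn ℂ (fun w => deriv Q w / Q w) (Metric.ball 0 1) :=
    (hQd.deriv Metric.isOpen_ball).div hQd hQ0
  obtain ⟨g, hg0, hg⟩ := (hlog.isExactOn_ball).with_val_at 0 (Complex.log (Q 0))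
  have hexp : ∀ w ∈ Metric.ball (0:ℂ) 1, Complex.exp (g w) = Q w := by
    have hder : ∀ w ∈ Metric.ball (0:ℂ) 1,
        HasDerivAt (fun w => Complex.exp (-g w) * Q w) 0 w := by
      intro w hw
      have h1 := ((hg w hw).neg.cexp).mul
        (hQd.differentiableAt (Metric.isOpen_ball.mem_nhds hw)).hasDerivAt
      have h2 := hQ0 w hw
      refine h1.congr_deriv ?_
      field_simp; ring
    intro w hw
    have hconst := (convex_ball (0:ℂ) 1).is_const_of_fderivWithin_eq_zero (𝕜 := ℂ)
      (f := fun w => Complex.exp (-g w) * Q w)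
      (fun x hx => (hder x hx).differentiableAt.differentiableWithinAt)
      (fun x hx => by
        rw [fderivWithin_of_isOpen Metric.isOpen_ball hx]
        ext
        simp [(hder x hx).deriv]) hw (Metric.mem_ball_self one_pos)
    simp only [hg0] at hconst
    rw [Complex.exp_neg, Complex.exp_neg, Complex.exp_log (hQ0 0 (by simp)),
      inv_mul_cancel₀ (hQ0 0 (by simp))] at hconst
    have := Complex.exp_ne_zero (g w)
    field_simp at hconst
    exact hconst.symm
  have hre : ∀ w ∈ Metric.ball (0:ℂ) 1, (-g w).re = -Real.log ‖Q w‖ := by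
    intro w hw
    rw [← hexp w hw, Complex.norm_exp, Real.log_exp, neg_re]
  have := harnack_ball (f := fun w => -g w)
    (fun x hx => (hg x hx).differentiableAt.neg.differentiableWithinAt)
    (fun w hw => by
      rw [hre w hw]
      have h1 := hle _ (mob_re_pos hc (show ‖w‖ < 1 by simpa using hw))
      have := Real.log_nonpos (norm_nonneg (Q w)) h1
      linarith) hw1
  rw [hre 0 (by simp), hre w (by simpa using hw1)] at this
  simp only [hQ, mob_zero] at this
  rw [hw, mob_inv hc hz, ← hw] at this
  refine this.trans ?_
  have h0 : 0 ≤ -Real.log ‖q c‖ := by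
    have := Real.log_nonpos (norm_nonneg (q c)) (hle c hc); linarith
  have : 0 < 1 - r := by linarith
  have : 0 ≤ 1 + r := by linarith [norm_nonneg w]
  gcongr

lemma vert_aux {u a t : ℝ} (hu : 0 < u) (hua : u ≤ a) :
    ‖((u:ℂ) + t * I) - ((a:ℂ) + t * I)‖ ≤
      ((a - u) / (a + u)) * ‖((u:ℂ) + t * I) + (starRingEnd ℂ) ((a:ℂ) + t * I)‖ := by
  have h1 : ((u:ℂ) + t * I) - ((a:ℂ) + t * I) = ((u - a : ℝ) : ℂ) := by push_cast; ring
  have h2 : ((u:ℂ) + t * I) + (starRingEnd ℂ) ((a:ℂ) + t * I) = ((u + a : ℝ) : ℂ) := by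
    simp
    ring
  rw [h1, h2, norm_real, norm_real, Real.norm_eq_abs, Real.norm_eq_abs,
    abs_of_nonpos (by linarith), abs_of_pos (by linarith)]
  have : a + u ≠ 0 := by linarith
  apply le_of_eq
  field_simp; ring

lemma vert_const {u a : ℝ} (hu : 0 < u) (hua : u ≤ a) :
    (1 + (a - u) / (a + u)) / (1 - (a - u) / (a + u)) = a / u := by
  have h1 : a + u ≠ 0 := by linarith
  have h2 : 1 - (a - u) / (a + u) = 2 * u / (a + u) := by field_simp; ring
  rw [h2]; field_simp; ring

lemma harnack_vert {f : ℂ → ℂ} (hf : DifferentiableOn ℂ f {z | 0 < z.re})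
    (hpos : ∀ z : ℂ, 0 < z.re → 0 ≤ (f z).re) {u a : ℝ} (t : ℝ) (hu : 0 < u) (hua : u ≤ a) :
    u * (f (u + t * I)).re ≤ a * (f (a + t * I)).re := by
  have := harnack_hp hf hpos (c := a + t * I) (z := u + t * I) (by simp; linarith)
    (by simpa using hu) (r := (a - u) / (a + u))
    (by rw [div_lt_one (by linarith)]; linarith) (vert_aux hu hua)
  rw [vert_const hu hua, div_mul_eq_mul_div, le_div_iff₀ hu] at this
  linarith

lemma harnack_log_vert {q : ℂ → ℂ} (hq : DifferentiableOn ℂ q {z | 0 < z.re})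
    (hne : ∀ z : ℂ, 0 < z.re → q z ≠ 0) (hle : ∀ z : ℂ, 0 < z.re → ‖q z‖ ≤ 1)
    {u a : ℝ} (t : ℝ) (hu : 0 < u) (hua : u ≤ a) :
    -Real.log ‖q (u + t * I)‖ ≤ a / u * (-Real.log ‖q (a + t * I)‖) := by
  have := harnack_log hq hne hle (c := a + t * I) (z := u + t * I) (by simp; linarith)
    (by simpa using hu) (r := (a - u) / (a + u))
    (by rw [div_lt_one (by linarith)]; linarith) (vert_aux hu hua)
  rwa [vert_const hu hua] at this

end CVS

namespace CVS

lemma cpow_diff_bound {s : ℂ} {m : ℝ} (hm : 1 ≤ m) (hs : 0 < s.re) {u : ℝ} (hu : u ∈ Set.Icc m (m+1)) :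
    ‖(u:ℂ) ^ (-s) - (m:ℂ) ^ (-s)‖ ≤ ‖s‖ * m ^ (-s.re - 1) := by
  have hder : ∀ x ∈ Set.Icc m (m+1), HasDerivWithinAt (fun x : ℝ => (x:ℂ) ^ (-s))
      (-s * (x:ℂ) ^ (-s - 1)) (Set.Icc m (m+1)) x := by
    intro x hx
    have hx0 : x ≠ 0 := by have := hx.1; linarith
    by_cases h : s = 0
    · simp [h] at hs
    exact (hasDerivAt_ofReal_cpow_const (x := x) hx0 (r := -s) (neg_ne_zero.mpr h)).hasDerivWithinAt
  have hb : ∀ x ∈ Set.Icc m (m+1), ‖-s * (x:ℂ) ^ (-s - 1)‖ ≤ ‖s‖ * m ^ (-s.re - 1) := by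
    intro x hx
    have hx0 : 0 < x := by have := hx.1; linarith
    rw [norm_mul, norm_neg, norm_cpow_eq_rpow_re_of_pos hx0]
    simp only [sub_re, neg_re, one_re]
    gcongr ‖s‖ * ?_
    exact Real.rpow_le_rpow_of_nonpos (by linarith) hx.1 (by linarith)
  have := (convex_Icc m (m+1)).norm_image_sub_le_of_norm_hasDerivWithin_le hder hb
    (Set.left_mem_Icc.mpr (by linarith)) hu
  refine this.trans ?_
  have h1 : ‖u - m‖ ≤ 1 := by
    rw [Real.norm_eq_abs, abs_of_nonneg (by linarith [hu.1])]; linarith [hu.2]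
  have : 0 ≤ ‖s‖ * m ^ (-s.re - 1) := by positivity
  nlinarith

noncomputable def aterm (n : ℕ) (s : ℂ) : ℂ :=
  (s - 1) * ((n + 1 : ℝ) : ℂ) ^ (-s) - (((n + 1 : ℝ) : ℂ) ^ (1 - s) - ((n + 2 : ℝ) : ℂ) ^ (1 - s))

lemma aterm_bound (n : ℕ) {s : ℂ} (hs : 0 < s.re) :
    ‖aterm n s‖ ≤ ‖s - 1‖ * ‖s‖ * (n + 1 : ℝ) ^ (-s.re - 1) := by
  set m : ℝ := n + 1 with hm
  have hm1 : 1 ≤ m := by rw [hm]; linarith [Nat.cast_nonneg (α := ℝ) n]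
  have hder : ∀ x ∈ Set.Icc m (m+1), HasDerivWithinAt
      (fun x : ℝ => (s - 1) * (m:ℂ) ^ (-s) * (x:ℂ) + (x:ℂ) ^ (1 - s))
      ((s - 1) * ((m:ℂ) ^ (-s) - (x:ℂ) ^ (-s))) (Set.Icc m (m+1)) x := by
    intro x hx
    have hx0 : x ≠ 0 := by have := hx.1; linarith
    by_cases h : 1 - s = 0
    · have h2 : s - 1 = 0 := by linear_combination -h
      simp only [h, h2, zero_mul, cpow_zero, zero_add]
      exact hasDerivWithinAt_const _ _ _
    have h1 := hasDerivAt_ofReal_cpow_const (x := x) hx0 (r := 1 - s) h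
    have h2 := (HasDerivAt.ofReal_comp (hasDerivAt_id x)).const_mul ((s - 1) * (m:ℂ) ^ (-s))
    refine ((h2.add h1).congr_deriv ?_).hasDerivWithinAt
    rw [show (1 - s - 1 : ℂ) = -s by ring]
    push_cast
    ring
  have hb : ∀ x ∈ Set.Icc m (m+1), ‖(s - 1) * ((m:ℂ) ^ (-s) - (x:ℂ) ^ (-s))‖ ≤
      ‖s - 1‖ * ‖s‖ * m ^ (-s.re - 1) := by
    intro x hx
    rw [norm_mul, norm_sub_rev (_ ^ _), mul_assoc]
    gcongr
    exact cpow_diff_bound hm1 hs hx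
  have := (convex_Icc m (m+1)).norm_image_sub_le_of_norm_hasDerivWithin_le hder hb
    (Set.left_mem_Icc.mpr (by linarith)) (Set.right_mem_Icc.mpr (by linarith))
  simp only [add_sub_cancel_left, norm_one, mul_one] at this
  refine le_trans (le_of_eq ?_) this
  congr 1
  unfold aterm
  rw [← hm]
  have : ((n + 2 : ℝ) : ℂ) = ((m + 1 : ℝ) : ℂ) := by rw [hm]; push_cast; ring
  rw [this]
  push_cast
  ring

lemma aterm_diff (n : ℕ) : Differentiable ℂ (aterm n) := by
  unfold aterm
  have h1 : ((n + 1 : ℝ) : ℂ) ≠ 0 := by exact_mod_cast (by positivity : (n + 1 : ℝ) ≠ 0)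
  have h2 : ((n + 2 : ℝ) : ℂ) ≠ 0 := by exact_mod_cast (by positivity : (n + 2 : ℝ) ≠ 0)
  intro s
  refine DifferentiableAt.sub (DifferentiableAt.mul (by fun_prop) ?_) (DifferentiableAt.sub ?_ ?_)
  · exact DifferentiableAt.const_cpow (by fun_prop) (Or.inl h1)
  · exact DifferentiableAt.const_cpow (by fun_prop) (Or.inl h1)
  · exact DifferentiableAt.const_cpow (by fun_prop) (Or.inl h2)

lemma summable_shift {σ : ℝ} (hσ : 1 < σ) : Summable (fun n : ℕ => (n + 1 : ℝ) ^ (-σ)) := by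
  have := (summable_nat_add_iff 1).mpr (Real.summable_nat_rpow.mpr (by linarith : -σ < -1))
  simpa using this

lemma zeta_real_le {σ : ℝ} (hσ : 1 < σ) : ∑' n : ℕ, (n + 1 : ℝ) ^ (-σ) ≤ σ / (σ - 1) := by
  have h := ZetaAsymptotics.zeta_limit_aux1 hσ
  have h2 : 0 ≤ ZetaAsymptotics.termTSum σ := tsum_nonneg fun n => ZetaAsymptotics.term_nonneg _ _
  have h3 : ∑' n : ℕ, (n + 1 : ℝ) ^ (-σ) = ∑' n : ℕ, 1 / (n + 1 : ℝ) ^ σ := by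
    congr 1; ext n; rw [Real.rpow_neg (by positivity), one_div]
  rw [h3]
  have h4 : σ / (σ - 1) = 1 + 1 / (σ - 1) := by
    have : σ - 1 ≠ 0 := by linarith
    field_simp; ring
  rw [h4]
  have : 0 ≤ σ * ZetaAsymptotics.termTSum σ := by positivity
  linarith

lemma zeta1_eq_of_one_lt {s : ℂ} (hs : 1 < s.re) : riemannZeta₁ s = 1 + ∑' n, aterm n s := by
  have hne : s ≠ 1 := by rintro rfl; simp at hs
  have h1 : riemannZeta₁ s = (s - 1) * riemannZeta s := by
    rw [riemannZeta_eq_inv_sub_mul hne]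
    have : s - 1 ≠ 0 := sub_ne_zero.mpr hne
    field_simp
  have hA : HasSum (fun n : ℕ => (s - 1) * ((n + 1 : ℝ) : ℂ) ^ (-s)) ((s - 1) * riemannZeta s) := by
    apply HasSum.mul_left
    rw [zeta_eq_tsum_one_div_nat_add_one_cpow hs]
    have hs' : Summable (fun n : ℕ => 1 / ((n:ℂ) + 1) ^ s) := by
      have := (summable_nat_add_iff 1).mpr (Complex.summable_one_div_nat_cpow.mpr hs)
      simpa using this
    have he : (fun n : ℕ => ((n + 1 : ℝ) : ℂ) ^ (-s)) = fun n : ℕ => 1 / ((n:ℂ) + 1) ^ s := by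
      funext n
      rw [Complex.cpow_neg, one_div]
      push_cast
      rfl
    rw [he]
    exact hs'.hasSum
  have hat : Summable (fun n => aterm n s) := by
    refine Summable.of_norm_bounded
      (g := fun n : ℕ => ‖s - 1‖ * ‖s‖ * (n + 1 : ℝ) ^ (-(s.re + 1)))
      ((summable_shift (by linarith)).mul_left _) fun n => ?_
    have := aterm_bound n (s := s) (by linarith)
    rwa [show -(s.re + 1) = -s.re - 1 by ring]
  have hB : HasSum (fun n : ℕ => (((n + 1 : ℝ) : ℂ) ^ (1 - s) - ((n + 2 : ℝ) : ℂ) ^ (1 - s))) 1 := by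
    have hsm : Summable (fun n : ℕ => (((n + 1 : ℝ) : ℂ) ^ (1 - s) - ((n + 2 : ℝ) : ℂ) ^ (1 - s))) := by
      refine (hA.summable.sub hat).congr fun n => ?_
      unfold aterm; ring
    rw [hsm.hasSum_iff_tendsto_nat]
    have hf : ∀ n : ℕ, ∑ i ∈ Finset.range n, (((i + 1 : ℝ) : ℂ) ^ (1 - s) - ((i + 2 : ℝ) : ℂ) ^ (1 - s))
        = 1 - ((n + 1 : ℝ) : ℂ) ^ (1 - s) := by
      intro n
      have := Finset.sum_range_sub' (fun i : ℕ => ((i + 1 : ℝ) : ℂ) ^ (1 - s)) n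
      simp only [Nat.cast_zero, zero_add, ofReal_one, one_cpow] at this
      rw [← this]
      refine Finset.sum_congr rfl fun i _ => ?_
      congr 2
      push_cast; ring
    simp_rw [hf]
    have h0 : Filter.Tendsto (fun n : ℕ => ((n + 1 : ℝ) : ℂ) ^ (1 - s)) Filter.atTop (nhds 0) := by
      rw [tendsto_zero_iff_norm_tendsto_zero]
      have h1 : ∀ n : ℕ, ‖((n + 1 : ℝ) : ℂ) ^ (1 - s)‖ = (n + 1 : ℝ) ^ (-(s.re - 1)) := by
        intro n
        rw [norm_cpow_eq_rpow_re_of_pos (by positivity)]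
        simp
      simp_rw [h1]
      refine (tendsto_rpow_neg_atTop (by linarith : 0 < s.re - 1)).comp ?_
      exact Filter.tendsto_atTop_add_const_right _ _ tendsto_natCast_atTop_atTop
    simpa using h0.const_sub 1
  have := (hA.sub hB).tsum_eq
  rw [h1]
  unfold aterm
  rw [this]; ring

lemma zeta1_eq {s : ℂ} (hs : 0 < s.re) : riemannZeta₁ s = 1 + ∑' n, aterm n s := by
  set U : Set ℂ := {z | s.re / (2 + s.re) < z.re} ∩ Metric.ball 0 (‖s‖ + 3) with hU
  have hσ : 0 < s.re / (2 + s.re) := by positivity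
  have hUo : IsOpen U := (isOpen_lt continuous_const continuous_re).inter Metric.isOpen_ball
  have hUc : Convex ℝ U := (convex_halfSpace_re_gt _).inter (convex_ball _ _)
  have hd : DifferentiableOn ℂ (fun z => 1 + ∑' n, aterm n z) U := by
    refine (differentiableOn_tsum_of_summable_norm
      (u := fun n : ℕ => (‖s‖ + 4) * (‖s‖ + 3) * (n + 1 : ℝ) ^ (-(s.re / (2 + s.re) + 1)))
      ?_ (fun n => (aterm_diff n).differentiableOn) hUo ?_).const_add 1
    · exact (summable_shift (by linarith)).mul_left _
    · intro n w hw
      have h1 : s.re / (2 + s.re) < w.re := hw.1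
      have h2 : ‖w‖ < ‖s‖ + 3 := by simpa using hw.2
      refine (aterm_bound n (by linarith)).trans ?_
      gcongr
      · have := norm_sub_le w 1
        simp at this; linarith
      · linarith [Nat.cast_nonneg (α := ℝ) n]
      · linarith
  have hse : s ∈ U := by
    refine ⟨?_, by simp⟩
    show s.re / (2 + s.re) < s.re
    rw [div_lt_iff₀ (by positivity)]; nlinarith
  have h2 : (2:ℂ) ∈ U := by
    refine ⟨?_, ?_⟩
    · show s.re / (2 + s.re) < (2:ℂ).re
      rw [div_lt_iff₀ (by positivity)]; simp; nlinarith
    · simp; linarith [norm_nonneg s]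
  have := (differentiable_riemannZeta₁.differentiableOn.analyticOnNhd hUo).eqOn_of_preconnected_of_eventuallyEq
    (hd.analyticOnNhd hUo) hUc.isPreconnected h2 (by
      have : {z : ℂ | 1 < z.re} ∈ nhds (2:ℂ) :=
        (isOpen_lt continuous_const continuous_re).mem_nhds (by simp)
      filter_upwards [this] with z hz
      exact zeta1_eq_of_one_lt hz)
  exact this hse

lemma zeta1_bound {s : ℂ} (hs : 0 < s.re) :
    ‖riemannZeta₁ s‖ ≤ 1 + ‖s - 1‖ * ‖s‖ * ((s.re + 1) / s.re) := by
  rw [zeta1_eq hs]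
  have hsum := (summable_shift (σ := s.re + 1) (by linarith)).mul_left (‖s - 1‖ * ‖s‖)
  have hb : ‖∑' n, aterm n s‖ ≤ ∑' n : ℕ, ‖s - 1‖ * ‖s‖ * (n + 1 : ℝ) ^ (-(s.re + 1)) := by
    refine tsum_of_norm_bounded hsum.hasSum fun n => ?_
    have := aterm_bound n hs
    rwa [show -(s.re + 1) = -s.re - 1 by ring]
  rw [tsum_mul_left] at hb
  have h2 := zeta_real_le (σ := s.re + 1) (by linarith)
  rw [add_sub_cancel_right] at h2
  calc _ ≤ ‖(1:ℂ)‖ + ‖∑' n, aterm n s‖ := norm_add_le _ _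
    _ ≤ _ := by
      rw [norm_one]
      gcongr
      exact hb.trans (by gcongr)

end CVS

namespace CVS

lemma zeta_norm_le {s : ℂ} (hs : 1 < s.re) : ‖riemannZeta s‖ ≤ s.re / (s.re - 1) := by
  rw [zeta_eq_tsum_one_div_nat_add_one_cpow hs]
  refine le_trans (tsum_of_norm_bounded (summable_shift hs).hasSum fun n => ?_) (zeta_real_le hs)
  have h : ((n:ℂ) + 1) = ((n + 1 : ℝ) : ℂ) := by push_cast; rfl
  rw [h, norm_div, norm_one, norm_cpow_eq_rpow_re_of_pos (by positivity),
    Real.rpow_neg (by positivity), one_div]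

lemma zeta_inv_norm_le {s : ℂ} (hs : 1 < s.re) : ‖(riemannZeta s)⁻¹‖ ≤ s.re / (s.re - 1) := by
  have h1 := ArithmeticFunction.LSeries_zeta_mul_Lseries_moebius hs
  rw [ArithmeticFunction.LSeries_zeta_eq_riemannZeta hs] at h1
  rw [inv_eq_of_mul_eq_one_right h1]
  refine le_trans ?_ (zeta_real_le hs)
  have hsum : Summable (fun n : ℕ => (n:ℝ) ^ (-s.re)) := Real.summable_nat_rpow.mpr (by linarith)
  have h2 : ∑' n : ℕ, (n:ℝ) ^ (-s.re) = ∑' n : ℕ, (n + 1 : ℝ) ^ (-s.re) := by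
    rw [hsum.tsum_eq_zero_add]
    simp [Real.zero_rpow (by linarith : -s.re ≠ 0)]
  rw [← h2]
  refine tsum_of_norm_bounded hsum.hasSum fun n => ?_
  rcases Nat.eq_zero_or_pos n with rfl | hn
  · simp [LSeries.term_def, Real.rpow_nonneg]
  · rw [LSeries.term_of_ne_zero hn.ne', norm_div, norm_natCast_cpow_of_pos hn,
      Real.rpow_neg (by positivity), div_eq_mul_inv]
    have : ‖((ArithmeticFunction.moebius n : ℤ) : ℂ)‖ ≤ 1 := by
      rw [Complex.norm_intCast]
      exact_mod_cast ArithmeticFunction.abs_moebius_le_one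
    have h3 : 0 ≤ ((n:ℝ) ^ s.re)⁻¹ := by positivity
    nlinarith

lemma zeta1_eq_mul {s : ℂ} (hne : s ≠ 1) : riemannZeta₁ s = (s - 1) * riemannZeta s := by
  rw [riemannZeta_eq_inv_sub_mul hne]
  have : s - 1 ≠ 0 := sub_ne_zero.mpr hne
  field_simp

lemma zeta1_ne_zero (hRH : RiemannHypothesis) {s : ℂ} (hs : 1/2 < s.re) : riemannZeta₁ s ≠ 0 := by
  by_cases hne : s = 1
  · rw [hne, riemannZeta₁_one]; exact one_ne_zero
  rw [zeta1_eq_mul hne]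
  refine mul_ne_zero (sub_ne_zero.mpr hne) fun h => ?_
  have := hRH s h ?_ hne
  · linarith
  · rintro ⟨n, hn⟩
    rw [hn] at hs
    simp at hs
    have : (0:ℝ) ≤ n := Nat.cast_nonneg n
    norm_num at hs
    linarith

end CVS

namespace CVS

lemma gamma_ge_one {b : ℝ} (hb : 0 < b) (hb1 : b ≤ 1) : 1 ≤ Real.Gamma b := by
  by_contra h
  push Not at h
  have hconv := Real.convexOn_Gamma
  rcases hb1.eq_or_lt with rfl | hb1
  · simp at h
  have h4 : (0:ℝ) < 2 - b := by linarith
  have hw1 : (0:ℝ) ≤ 1 / (2 - b) := by positivity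
  have hw2 : (0:ℝ) ≤ (1 - b) / (2 - b) := div_nonneg (by linarith) (by linarith)
  have hw3 : 1 / (2 - b) + (1 - b) / (2 - b) = 1 := by
    rw [← add_div, div_eq_one_iff_eq h4.ne']; ring
  have h2 := hconv.2 (show b ∈ Set.Ioi (0:ℝ) from hb)
    (show (2:ℝ) ∈ Set.Ioi (0:ℝ) by simp) hw1 hw2 hw3
  have h3 : (1 / (2 - b)) • b + ((1 - b) / (2 - b)) • (2:ℝ) = 1 := by
    have : (2 - b : ℝ) ≠ 0 := by linarith
    simp only [smul_eq_mul]; field_simp; ring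
  rw [h3, Real.Gamma_one, Real.Gamma_two] at h2
  simp only [smul_eq_mul] at h2
  have h5 : 1 / (2 - b) * Real.Gamma b + (1 - b) / (2 - b) * 1 = (Real.Gamma b + 1 - b) / (2 - b) := by
    field_simp; ring
  rw [h5, le_div_iff₀ h4] at h2
  linarith

lemma gamma_ratio {s0 b0 : ℝ} (hs0 : 0 < s0) (hb0 : 0 < b0) :
    ∃ K : ℝ, 0 < K ∧ ∀ (s : ℂ) (b : ℝ), s0 ≤ s.re → b0 ≤ b → b ≤ 1 →
      ‖Complex.Gamma s‖ ≤ K * ‖Complex.Gamma (s + b)‖ := by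
  have hconv := Complex.betaIntegral_convergent (u := s0) (v := b0) (by simpa using hs0) (by simpa using hb0)
  have hintg : IntervalIntegrable (fun y : ℝ => y ^ (s0 - 1) * (1 - y) ^ (b0 - 1)) volume 0 1 := by
    have := hconv.norm
    refine this.congr_ae ?_
    rw [Set.uIoc_of_le zero_le_one, ← restrict_Ioo_eq_restrict_Ioc]
    refine (ae_restrict_iff' measurableSet_Ioo).mpr (Filter.Eventually.of_forall fun y hy => ?_)
    simp only [norm_mul]
    have hc : (1 - (y:ℂ)) = ((1 - y : ℝ) : ℂ) := by push_cast; rfl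
    rw [norm_cpow_eq_rpow_re_of_pos hy.1, hc,
      norm_cpow_eq_rpow_re_of_pos (by linarith [hy.2])]
    simp
  set J := ∫ y in (0:ℝ)..1, y ^ (s0 - 1) * (1 - y) ^ (b0 - 1) with hJ
  have hJ0 : 0 ≤ J := by
    refine intervalIntegral.integral_nonneg zero_le_one fun y hy => ?_
    exact mul_nonneg (Real.rpow_nonneg hy.1 _) (Real.rpow_nonneg (by linarith [hy.2]) _)
  refine ⟨J + 1, by linarith, fun s b hs hb hb1 => ?_⟩
  have hbpos : 0 < b := by linarith
  have hB := Complex.Gamma_mul_Gamma_eq_betaIntegral (s := s) (t := b) (by linarith) (by simpa using hbpos)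
  have hbound : ‖Complex.betaIntegral s b‖ ≤ J := by
    unfold Complex.betaIntegral
    refine intervalIntegral.norm_integral_le_of_norm_le zero_le_one ?_ hintg
    have h01 : ∀ᵐ y : ℝ, y ≠ 1 := by simp [ae_iff]
    filter_upwards [h01] with y hy1 hy
    have hylt : y < 1 := lt_of_le_of_ne hy.2 hy1
    have hc : (1 - (y:ℂ)) = ((1 - y : ℝ) : ℂ) := by push_cast; rfl
    rw [norm_mul, norm_cpow_eq_rpow_re_of_pos hy.1, hc,
      norm_cpow_eq_rpow_re_of_pos (by linarith)]
    simp only [sub_re, ofReal_re, one_re]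
    have e1 : y ^ (s.re - 1) ≤ y ^ (s0 - 1) :=
      Real.rpow_le_rpow_of_exponent_ge hy.1 hy.2 (by linarith)
    have e2 : (1 - y) ^ (b - 1) ≤ (1 - y) ^ (b0 - 1) :=
      Real.rpow_le_rpow_of_exponent_ge (by linarith) (by linarith [hy.1]) (by linarith)
    have := hy.1
    have h1y : 0 ≤ 1 - y := by linarith
    gcongr
  have hgb : 1 ≤ ‖Complex.Gamma b‖ := by
    rw [Complex.Gamma_ofReal, Complex.norm_real]
    exact (gamma_ge_one hbpos hb1).trans (le_abs_self _)
  calc ‖Complex.Gamma s‖ ≤ ‖Complex.Gamma s‖ * ‖Complex.Gamma b‖ := by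
        nlinarith [norm_nonneg (Complex.Gamma s)]
    _ = ‖Complex.Gamma (s + b)‖ * ‖Complex.betaIntegral s b‖ := by
        rw [← norm_mul, ← norm_mul, hB]
    _ ≤ _ := by
        nlinarith [norm_nonneg (Complex.Gamma (s + b)), norm_nonneg (Complex.betaIntegral s b)]

end CVS

namespace CVS

noncomputable def xi (s : ℂ) : ℂ := s * (s - 1) * completedRiemannZeta₀ s + 1

lemma xi_diff : Differentiable ℂ xi := by
  unfold xi
  have := differentiable_completedZeta₀
  fun_prop

lemma xi_one_sub (s : ℂ) : xi (1 - s) = xi s := by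
  unfold xi
  rw [completedRiemannZeta₀_one_sub]; ring

lemma xi_eq {s : ℂ} (hs : 0 < s.re) : xi s = s * Gammaℝ s * riemannZeta₁ s := by
  have h0 : s ≠ 0 := by rintro rfl; simp at hs
  by_cases h1 : s = 1
  · rw [h1, riemannZeta₁_one, Gammaℝ_one]; simp [xi]
  have h2 : s - 1 ≠ 0 := sub_ne_zero.mpr h1
  have h2' : 1 - s ≠ 0 := sub_ne_zero.mpr (Ne.symm h1)
  rw [zeta1_eq_mul h1, riemannZeta_def_of_ne_zero h0, completedRiemannZeta_eq]
  have := Gammaℝ_ne_zero_of_re_pos hs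
  unfold xi
  field_simp
  ring

lemma xi_ne_zero (hRH : RiemannHypothesis) {s : ℂ} (hs : 1/2 < s.re) : xi s ≠ 0 := by
  rw [xi_eq (by linarith)]
  have h0 : s ≠ 0 := by rintro rfl; norm_num at hs
  exact mul_ne_zero (mul_ne_zero h0 (Gammaℝ_ne_zero_of_re_pos (by linarith))) (zeta1_ne_zero hRH hs)

lemma norm_gammaR (s : ℂ) : ‖Gammaℝ s‖ = π ^ (-s.re / 2) * ‖Complex.Gamma (s / 2)‖ := by
  rw [Gammaℝ_def, norm_mul, norm_cpow_eq_rpow_re_of_pos Real.pi_pos]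
  congr 2
  simp [neg_div]

lemma norm_zeta1_conj (s : ℂ) : ‖riemannZeta₁ ((starRingEnd ℂ) s)‖ = ‖riemannZeta₁ s‖ := by
  by_cases h : s = 1
  · simp [h]
  have h' : (starRingEnd ℂ) s ≠ 1 := by
    intro h2; apply h
    have := congrArg (starRingEnd ℂ) h2
    simpa using this
  rw [zeta1_eq_mul h, zeta1_eq_mul h', riemannZeta_conj, norm_mul, norm_mul, Complex.norm_conj]
  congr 1
  rw [← Complex.norm_conj (s - 1)]
  simp

lemma norm_xi_conj {s : ℂ} (hs : 0 < s.re) : ‖xi ((starRingEnd ℂ) s)‖ = ‖xi s‖ := by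
  rw [xi_eq hs, xi_eq (by simpa using hs)]
  simp only [norm_mul, Complex.norm_conj, norm_gammaR, norm_zeta1_conj, Complex.conj_re]
  have : (starRingEnd ℂ) s / 2 = (starRingEnd ℂ) (s / 2) := by
    rw [map_div₀]; congr 1; exact (Complex.conj_ofNat 2).symm
  rw [this, Complex.Gamma_conj, Complex.norm_conj]

lemma gammaR_ratio {s0 b0 : ℝ} (hs0 : 0 < s0) (hb0 : 0 < b0) :
    ∃ K : ℝ, 0 < K ∧ ∀ (s : ℂ) (b : ℝ), s0 ≤ s.re → b0 ≤ b → b ≤ 1 →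
      ‖s‖ * ‖Gammaℝ s‖ ≤ K * (‖s + b‖ * ‖Gammaℝ (s + b)‖) := by
  obtain ⟨K, hK, h⟩ := gamma_ratio (s0 := s0 / 2) (b0 := b0 / 2) (by positivity) (by positivity)
  refine ⟨π * K, by positivity, fun s b hs hb hb1 => ?_⟩
  have h1 := h (s / 2) (b / 2) (by simp; linarith) (by linarith) (by linarith)
  have e1 : s / 2 + ((b / 2 : ℝ) : ℂ) = (s + b) / 2 := by push_cast; ring
  rw [e1] at h1
  rw [norm_gammaR, norm_gammaR]
  have h2 : ‖s‖ ≤ ‖s + b‖ := by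
    rw [← Real.sqrt_sq (norm_nonneg s), ← Real.sqrt_sq (norm_nonneg (s + b)), ← normSq_eq_norm_sq,
      ← normSq_eq_norm_sq, normSq_apply, normSq_apply]
    apply Real.sqrt_le_sqrt
    simp
    nlinarith
  have h3 : π ^ (-s.re / 2) ≤ π * π ^ (-(s + b).re / 2) := by
    have : π * π ^ (-(s + b).re / 2) = π ^ (1 + -(s + b).re / 2) := by
      rw [Real.rpow_add Real.pi_pos, Real.rpow_one]
    rw [this]
    apply Real.rpow_le_rpow_of_exponent_le (by linarith [Real.pi_gt_three])
    simp
    linarith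
  calc _ ≤ ‖s + b‖ * ((π * π ^ (-(s + b).re / 2)) * (K * ‖Complex.Gamma ((s + b) / 2)‖)) := by
        gcongr
    _ = _ := by ring

/-- polynomial lower bound for the zeta function to the right of the critical line -/
lemma zeta1_inv_bound (hRH : RiemannHypothesis) {h : ℝ} (h0 : 0 < h) {z : ℂ} (hh : h ≤ 1/2)
    (hz : h / 2 ≤ z.re) :
    ‖(riemannZeta₁ (1/2 + z))⁻¹‖ ≤ (8 * (‖z‖ + 5/2) ^ 2) ^ (3 / h) := by
  have hX : 0 ≤ ‖z‖ := norm_nonneg z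
  have hbase : 1 ≤ 8 * (‖z‖ + 5/2) ^ 2 := by nlinarith
  have hexp : 1 ≤ 3 / h := by rw [le_div_iff₀ h0]; linarith
  have h2 : ∀ {w : ℂ}, 2 ≤ w.re → ‖(riemannZeta₁ w)⁻¹‖ ≤ 2 := by
    intro w hw
    have hw1 : w ≠ 1 := by rintro rfl; norm_num at hw
    rw [zeta1_eq_mul hw1, mul_inv, norm_mul, norm_inv]
    have a1 : ‖(riemannZeta w)⁻¹‖ ≤ 2 := by
      refine (zeta_inv_norm_le (by linarith)).trans ?_
      rw [div_le_iff₀ (by linarith)]; linarith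
    have a2 : 1 ≤ ‖w - 1‖ := by
      refine le_trans ?_ (Complex.re_le_norm _)
      simp; linarith
    have a3 : ‖w - 1‖⁻¹ ≤ 1 := inv_le_one_of_one_le₀ a2
    have : 0 ≤ ‖w - 1‖⁻¹ := by positivity
    nlinarith [norm_nonneg (riemannZeta w)⁻¹]
  rcases le_or_gt (3/2) z.re with hbig | hsmall
  · refine (h2 (by simp; linarith)).trans ?_
    have : 8 * (‖z‖ + 5/2) ^ 2 ≤ (8 * (‖z‖ + 5/2) ^ 2) ^ (3 / h) := Real.self_le_rpow_of_one_le hbase hexp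
    nlinarith
  set q : ℂ → ℂ := fun z => riemannZeta₁ (1/2 + z) / (4 * (z + 1) ^ 2) with hq
  have hz1 : ∀ w : ℂ, 0 < w.re → w + 1 ≠ 0 := by
    intro w hw h; have := congrArg Complex.re h; simp at this; linarith
  have hn1 : ∀ w : ℂ, 0 < w.re → 1 ≤ ‖w + 1‖ := by
    intro w hw
    refine le_trans ?_ (Complex.re_le_norm _)
    simp; linarith
  have hqd : DifferentiableOn ℂ q {z | 0 < z.re} := by
    intro w hw
    apply DifferentiableAt.differentiableWithinAt
    refine DifferentiableAt.div ?_ (by fun_prop) ?_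
    · exact (differentiable_riemannZeta₁.comp (by fun_prop : Differentiable ℂ fun z : ℂ => 1/2 + z)) w
    · exact mul_ne_zero (by norm_num) (pow_ne_zero 2 (hz1 w hw))
  have hqne : ∀ z : ℂ, 0 < z.re → q z ≠ 0 := by
    intro w hw
    exact div_ne_zero (zeta1_ne_zero hRH (by simp; linarith))
      (mul_ne_zero (by norm_num) (pow_ne_zero 2 (hz1 w hw)))
  have hqle : ∀ z : ℂ, 0 < z.re → ‖q z‖ ≤ 1 := by
    intro w hw
    have hb := zeta1_bound (s := 1/2 + w) (by simp; linarith)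
    have hn := hn1 w hw
    simp only [hq]
    rw [norm_div, norm_mul, norm_pow, div_le_one (by simp; positivity)]
    refine hb.trans ?_
    have e1 : ‖1/2 + w - 1‖ ≤ ‖w + 1‖ := by
      rw [← sq_le_sq₀ (norm_nonneg _) (norm_nonneg _), ← normSq_eq_norm_sq,
        ← normSq_eq_norm_sq, normSq_apply, normSq_apply]
      simp
      nlinarith
    have e2 : ‖1/2 + w‖ ≤ ‖w + 1‖ := by
      rw [← sq_le_sq₀ (norm_nonneg _) (norm_nonneg _), ← normSq_eq_norm_sq,
        ← normSq_eq_norm_sq, normSq_apply, normSq_apply]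
      simp
      nlinarith
    have e3 : ((1/2 + w).re + 1) / (1/2 + w).re ≤ 3 := by
      have : (1/2 + w).re = 1/2 + w.re := by simp
      rw [this, div_le_iff₀ (by linarith)]; linarith
    have e4 : ‖(4:ℂ)‖ = 4 := by simp
    rw [e4]
    calc _ ≤ 1 + ‖w + 1‖ * ‖w + 1‖ * 3 := by
          have e5 : 0 ≤ ((1/2 + w).re + 1) / (1/2 + w).re := by
            have : (1/2 + w).re = 1/2 + w.re := by simp
            rw [this]; positivity
          gcongr
      _ ≤ _ := by nlinarith
  have hzz : z = ((z.re : ℝ) : ℂ) + z.im * I := (Complex.re_add_im z).symm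
  have hu : 0 < z.re := by linarith
  have hH := harnack_log_vert hqd hqne hqle (u := z.re) (a := 3/2) z.im hu hsmall.le
  rw [← hzz] at hH
  set c : ℂ := ((3/2 : ℝ) : ℂ) + z.im * I with hc
  have hcre : c.re = 3/2 := by simp [hc]
  have hcn : ‖c + 1‖ ≤ ‖z‖ + 5/2 := by
    have : c + 1 = ((5/2 : ℝ) : ℂ) + z.im * I := by rw [hc]; push_cast; ring
    rw [this]
    refine (norm_add_le _ _).trans ?_
    have a1 := Complex.abs_im_le_norm z
    rw [Complex.norm_real, norm_mul, Complex.norm_real, Complex.norm_I]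
    simp only [Real.norm_eq_abs, mul_one]
    rw [abs_of_pos (by norm_num)]
    linarith
  have hqc : (8 * (‖z‖ + 5/2) ^ 2)⁻¹ ≤ ‖q c‖ := by
    have a1 := h2 (w := 1/2 + c) (by simp [hcre]; norm_num)
    have a2 : riemannZeta₁ (1/2 + c) ≠ 0 := zeta1_ne_zero hRH (by simp [hcre])
    have a3 : 1/2 ≤ ‖riemannZeta₁ (1/2 + c)‖ := by
      rw [norm_inv] at a1
      have := norm_pos_iff.mpr a2
      rw [inv_le_comm₀ this (by norm_num)] at a1
      linarith
    have a4 : 1 ≤ ‖c + 1‖ := hn1 c (by rw [hcre]; norm_num)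
    simp only [hq]
    rw [norm_div, norm_mul, norm_pow, show ‖(4:ℂ)‖ = 4 by simp]
    calc (8 * (‖z‖ + 5/2) ^ 2)⁻¹ ≤ (8 * ‖c + 1‖ ^ 2)⁻¹ := by gcongr
      _ = (1/2) / (4 * ‖c + 1‖ ^ 2) := by field_simp; norm_num
      _ ≤ _ := by gcongr
  have hqc0 : 0 < ‖q c‖ := norm_pos_iff.mpr (hqne c (by rw [hcre]; norm_num))
  have hqz0 : 0 < ‖q z‖ := norm_pos_iff.mpr (hqne z hu)
  have hlog1 : -Real.log ‖q c‖ ≤ Real.log (8 * (‖z‖ + 5/2) ^ 2) := by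
    rw [← Real.log_inv]
    apply Real.log_le_log (by positivity)
    rw [inv_le_comm₀ hqc0 (by positivity)]
    exact hqc
  have hlog0 : 0 ≤ -Real.log ‖q c‖ := by
    have := Real.log_nonpos (norm_nonneg _) (hqle c (by rw [hcre]; norm_num))
    linarith
  have hfac : 3 / 2 / z.re ≤ 3 / h := by
    rw [div_le_div_iff₀ hu h0]; linarith
  have hfin : -Real.log ‖q z‖ ≤ Real.log (8 * (‖z‖ + 5/2) ^ 2) * (3 / h) := by
    refine hH.trans ?_
    rw [mul_comm]
    have hlog2 := Real.log_nonneg hbase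
    gcongr
  have hfin2 : ‖q z‖⁻¹ ≤ (8 * (‖z‖ + 5/2) ^ 2) ^ (3 / h) := by
    rw [Real.rpow_def_of_pos (by positivity), ← Real.exp_log (inv_pos.mpr hqz0), Real.log_inv]
    exact Real.exp_le_exp.mpr hfin
  refine le_trans ?_ hfin2
  rw [norm_inv]
  apply inv_anti₀ hqz0
  simp only [hq]
  rw [norm_div, norm_mul, norm_pow, show ‖(4:ℂ)‖ = 4 by simp]
  have := hn1 z hu
  apply div_le_self (norm_nonneg _)
  nlinarith

end CVS

namespace CVS

lemma xi_mono_aux (hRH : RiemannHypothesis) {h : ℝ} (h0 : 0 < h) (hh : h ≤ 1/2) {z : ℂ}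
    (hz : 0 ≤ z.re) : ‖xi ((1/2 - h/2 : ℝ) + z)‖ ≤ ‖xi ((1/2 + h/2 : ℝ) + z)‖ := by
  set G : ℂ → ℂ := fun z => xi ((1/2 - h/2 : ℝ) + z) / xi ((1/2 + h/2 : ℝ) + z) with hG
  have hne : ∀ w : ℂ, 0 ≤ w.re → xi ((1/2 + h/2 : ℝ) + w) ≠ 0 := by
    intro w hw
    apply xi_ne_zero hRH
    rw [add_re, ofReal_re]; linarith
  obtain ⟨K, hK, hKr⟩ := gammaR_ratio (s0 := 1/4) (b0 := h) (by norm_num) h0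
  have hcb : ∀ w : ℂ, 0 ≤ w.re → ‖G w‖ ≤ K * (‖riemannZeta₁ ((1/2 - h/2 : ℝ) + w)‖ *
      ‖(riemannZeta₁ ((1/2 + h/2 : ℝ) + w))⁻¹‖) := by
    intro w hw
    simp only [hG]
    set s : ℂ := ((1/2 - h/2 : ℝ) : ℂ) + w with hs
    have hsh : ((1/2 + h/2 : ℝ) : ℂ) + w = s + h := by rw [hs]; push_cast; ring
    have hsre : 1/4 ≤ s.re := by rw [hs, add_re, ofReal_re]; linarith
    have hshre : 1/2 < (s + h).re := by rw [← hsh, add_re, ofReal_re]; linarith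
    have hne' := hne w hw
    rw [hsh] at hne' ⊢
    have h1 := hKr s h hsre le_rfl (by linarith)
    have hz1 := norm_pos_iff.mpr (zeta1_ne_zero hRH hshre)
    rw [norm_div, div_le_iff₀ (norm_pos_iff.mpr hne'), xi_eq (by linarith), xi_eq (by linarith),
      norm_mul, norm_mul, norm_mul, norm_mul, norm_inv]
    calc _ ≤ K * (‖s + h‖ * ‖Gammaℝ (s + h)‖) * ‖riemannZeta₁ s‖ := by gcongr
      _ = _ := by field_simp
  have hd : DiffContOnCl ℂ G {z | 0 < z.re} := by
    have hcl : closure {z : ℂ | 0 < z.re} = {z : ℂ | 0 ≤ z.re} := Complex.closure_setOfPred_lt_re 0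
    apply DifferentiableOn.diffContOnCl
    rw [hcl]
    intro w hw
    apply DifferentiableAt.differentiableWithinAt
    have := xi_diff
    exact DifferentiableAt.div (by fun_prop) (by fun_prop) (hne w hw)
  have hexp : ∃ c < (2 : ℝ), ∃ B, G =O[Bornology.cobounded ℂ ⊓ Filter.principal {z | 0 < z.re}]
      fun z => Real.exp (B * ‖z‖ ^ c) := by
    refine ⟨1, by norm_num, 2 + 6 / h, ?_⟩
    apply Asymptotics.IsBigO.of_bound (K * 54 * 72 ^ (3 / h))
    refine Filter.Eventually.filter_mono inf_le_right ?_
    rw [Filter.eventually_principal]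
    intro w hw
    have hw : 0 < w.re := hw
    have hX : 0 ≤ ‖w‖ := norm_nonneg w
    refine (hcb w hw.le).trans ?_
    rw [Real.rpow_one, Real.norm_eq_abs, abs_of_pos (Real.exp_pos _)]
    have hE : ‖w‖ + 5/2 ≤ 3 * Real.exp ‖w‖ := by linarith [Real.add_one_le_exp ‖w‖]
    have hz1 : ‖riemannZeta₁ ((1/2 - h/2 : ℝ) + w)‖ ≤ 54 * Real.exp ‖w‖ ^ 2 := by
      set s : ℂ := ((1/2 - h/2 : ℝ) : ℂ) + w with hs
      have hsre : s.re = 1/2 - h/2 + w.re := by rw [hs, add_re, ofReal_re]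
      refine (zeta1_bound (by linarith)).trans ?_
      have e1 : ‖s‖ ≤ ‖w‖ + 1 := by
        refine (norm_add_le _ _).trans ?_
        rw [Complex.norm_real, Real.norm_eq_abs, abs_of_pos (by linarith)]; linarith
      have e2 : ‖s - 1‖ ≤ ‖w‖ + 2 := by
        refine (norm_sub_le _ _).trans ?_
        rw [norm_one]; linarith
      have e3 : (s.re + 1) / s.re ≤ 5 := by
        rw [div_le_iff₀ (by linarith)]; linarith
      have e4 : 0 ≤ (s.re + 1) / s.re := div_nonneg (by linarith) (by linarith)
      calc _ ≤ 1 + (‖w‖ + 2) * (‖w‖ + 1) * 5 := by gcongr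
        _ ≤ 6 * (‖w‖ + 5/2) ^ 2 := by nlinarith
        _ ≤ 6 * (3 * Real.exp ‖w‖) ^ 2 := by gcongr
        _ = _ := by ring
    have hz2 : ‖(riemannZeta₁ ((1/2 + h/2 : ℝ) + w))⁻¹‖ ≤ 72 ^ (3/h) * Real.exp (‖w‖ * (6/h)) := by
      have e0 : ((1/2 + h/2 : ℝ) : ℂ) + w = 1/2 + (((h/2 : ℝ) : ℂ) + w) := by push_cast; ring
      rw [e0]
      refine (zeta1_inv_bound hRH h0 hh (by rw [add_re, ofReal_re]; linarith)).trans ?_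
      have e1 : ‖((h/2 : ℝ) : ℂ) + w‖ + 5/2 ≤ 3 * Real.exp ‖w‖ := by
        have := norm_add_le ((h/2 : ℝ) : ℂ) w
        rw [Complex.norm_real, Real.norm_eq_abs, abs_of_pos (by linarith)] at this
        linarith [Real.add_one_le_exp ‖w‖]
      calc (8 * (‖((h/2 : ℝ) : ℂ) + w‖ + 5/2) ^ 2) ^ (3/h)
          ≤ (8 * (3 * Real.exp ‖w‖) ^ 2) ^ (3/h) := by gcongr
        _ = (72 * Real.exp (‖w‖ * 2)) ^ (3/h) := by
            congr 1
            rw [Real.exp_mul, show (2:ℝ) = ((2:ℕ):ℝ) by norm_num, Real.rpow_natCast]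
            ring
        _ = _ := by
            rw [Real.mul_rpow (by norm_num) (Real.exp_pos _).le, ← Real.exp_mul]
            congr 2; ring
    calc _ ≤ K * (54 * Real.exp ‖w‖ ^ 2 * (72 ^ (3/h) * Real.exp (‖w‖ * (6/h)))) := by gcongr
      _ = _ := by
        rw [show (2 + 6 / h) * ‖w‖ = ‖w‖ + ‖w‖ + ‖w‖ * (6/h) by ring, Real.exp_add, Real.exp_add]
        ring
  have hre : Filter.IsBoundedUnder (· ≤ ·) Filter.atTop fun x : ℝ => ‖G x‖ := by
    refine ⟨K * 4, ?_⟩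
    rw [Filter.eventually_map]
    filter_upwards [Filter.eventually_ge_atTop 2] with x hx
    refine (hcb x (by simp; linarith)).trans ?_
    gcongr
    have c1 : ((1/2 - h/2 : ℝ) : ℂ) + x = ((1/2 - h/2 + x : ℝ) : ℂ) := by push_cast; ring
    have c2 : ((1/2 + h/2 : ℝ) : ℂ) + x = ((1/2 + h/2 + x : ℝ) : ℂ) := by push_cast; ring
    rw [c1, c2]
    have hn : ∀ y : ℝ, 2 ≤ y + 3/4 → (y:ℂ) ≠ 1 := by
      intro y hy h; 
      have : y = 1 := by exact_mod_cast h
      linarith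
    have hn2 : ∀ y : ℝ, 1 < y → ‖(y:ℂ) - 1‖ = y - 1 := by
      intro y hy
      rw [← ofReal_one, ← ofReal_sub, Complex.norm_real, Real.norm_eq_abs, abs_of_pos (by linarith)]
    rw [zeta1_eq_mul (hn _ (by linarith)), zeta1_eq_mul (hn _ (by linarith)), norm_mul, mul_inv,
      norm_mul, norm_inv, hn2 _ (by linarith), hn2 _ (by linarith)]
    have b1 := zeta_norm_le (s := ((1/2 - h/2 + x : ℝ) : ℂ)) (by rw [ofReal_re]; linarith)
    have b2 := zeta_inv_norm_le (s := ((1/2 + h/2 + x : ℝ) : ℂ)) (by rw [ofReal_re]; linarith)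
    rw [ofReal_re] at b1 b2
    have b1' : (1/2 - h/2 + x) / (1/2 - h/2 + x - 1) ≤ 2 := by
      rw [div_le_iff₀ (by linarith)]; linarith
    have b2' : (1/2 + h/2 + x) / (1/2 + h/2 + x - 1) ≤ 2 := by
      rw [div_le_iff₀ (by linarith)]; linarith
    have b1'' := b1.trans b1'
    have b2'' := b2.trans b2'
    have hp1 : 0 ≤ 1/2 - h/2 + x - 1 := by linarith
    have hp2 : 0 < 1/2 + h/2 + x - 1 := by linarith
    calc _ ≤ (1/2 - h/2 + x - 1) * 2 * ((1/2 + h/2 + x - 1)⁻¹ * 2) := by gcongr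
      _ = 4 * ((1/2 - h/2 + x - 1) / (1/2 + h/2 + x - 1)) := by rw [div_eq_mul_inv]; ring
      _ ≤ 4 * 1 := by
        gcongr
        rw [div_le_one hp2]; linarith
      _ = 4 := by norm_num
  have him : ∀ x : ℝ, ‖G (x * I)‖ ≤ 1 := by
    intro x
    simp only [hG]
    have hw := hne (x * I) (by simp)
    rw [norm_div, div_le_one (norm_pos_iff.mpr hw)]
    set s : ℂ := ((1/2 + h/2 : ℝ) : ℂ) + x * I with hs
    have : ((1/2 - h/2 : ℝ) : ℂ) + x * I = 1 - (starRingEnd ℂ) s := by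
      have hr : s.re = 1/2 + h/2 := by
        rw [hs, add_re, ofReal_re]; simp
      have hi : s.im = x := by
        rw [hs, add_im, ofReal_im]; simp
      apply Complex.ext
      · rw [sub_re, conj_re, hr, one_re, add_re, ofReal_re]; simp; ring
      · rw [sub_im, conj_im, hi, one_im, add_im, ofReal_im]; simp
    rw [this, xi_one_sub, norm_xi_conj]
    rw [hs, add_re, ofReal_re]; simp; linarith
  have := PhragmenLindelof.right_half_plane_of_bounded_on_real hd hexp hre him hz
  simp only [hG] at this
  rwa [norm_div, div_le_one (norm_pos_iff.mpr (hne z hz))] at this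

end CVS

namespace CVS

noncomputable def F (z : ℂ) : ℂ := deriv xi (1/2 + z) / xi (1/2 + z)

noncomputable def Lg (t u : ℝ) : ℝ := Real.log ‖xi (1/2 + (u + t * I))‖

lemma half_ne (hRH : RiemannHypothesis) {z : ℂ} (hz : 0 < z.re) : xi (1/2 + z) ≠ 0 :=
  xi_ne_zero hRH (by simp; linarith)

lemma F_diff (hRH : RiemannHypothesis) : DifferentiableOn ℂ F {z | 0 < z.re} := by
  intro z hz
  apply DifferentiableAt.differentiableWithinAt
  have h1 : Differentiable ℂ (deriv xi) := by
    have := xi_diff.contDiff (n := 2)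
    exact ((contDiff_succ_iff_deriv (n := 1)).mp this).2.2.differentiable (by norm_num)
  have h2 := xi_diff
  exact DifferentiableAt.div (by fun_prop) (by fun_prop) (half_ne hRH hz)

lemma Lg_hasDeriv (hRH : RiemannHypothesis) (t : ℝ) {u : ℝ} (hu : 0 < u) :
    HasDerivAt (Lg t) (F (u + t * I)).re u := by
  have hne : xi (1/2 + (u + t * I)) ≠ 0 := half_ne hRH (by simpa using hu)
  have h0 : HasDerivAt (fun u : ℝ => (1/2 : ℂ) + (u + t * I)) 1 u := by
    exact ((HasDerivAt.ofReal_comp (hasDerivAt_id u)).add_const (t * I)).const_add (1/2 : ℂ)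
  have h1 : HasDerivAt (fun u : ℝ => xi (1/2 + (u + t * I))) (deriv xi (1/2 + (u + t * I)) * 1) u :=
    HasDerivAt.comp (h₂ := xi) (h := fun u : ℝ => (1/2 : ℂ) + (u + t * I)) u
      (xi_diff (1/2 + (u + t * I))).hasDerivAt h0
  have h2 := h1.norm_sq
  have h3 := (h2.log (by positivity)).const_mul (1/2 : ℝ)
  have e : Lg t = fun u : ℝ => 1/2 * Real.log (‖xi (1/2 + (u + t * I))‖ ^ 2) := by
    funext v
    rw [Real.log_pow]
    unfold Lg
    push_cast; ring
  rw [e]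
  refine h3.congr_deriv ?_
  unfold F
  rw [mul_one, Complex.inner, Complex.div_re, ← normSq_eq_norm_sq]
  simp only [mul_re, conj_re, conj_im]
  have : normSq (xi (1/2 + (u + t * I))) ≠ 0 := by simpa using hne
  field_simp
  ring

lemma Lg_mono (hRH : RiemannHypothesis) (t : ℝ) {u v : ℝ} (hu : 0 < u) (huv : u < v)
    (hv : v ≤ u + 1/2) : Lg t u ≤ Lg t v := by
  have := xi_mono_aux hRH (h := v - u) (by linarith) (by linarith)
    (z := ((u + v) / 2 : ℝ) + t * I) (by rw [add_re, ofReal_re]; simp; linarith)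
  have e1 : ((1/2 - (v - u)/2 : ℝ) : ℂ) + (((u + v) / 2 : ℝ) + t * I) = 1/2 + (u + t * I) := by
    push_cast; ring
  have e2 : ((1/2 + (v - u)/2 : ℝ) : ℂ) + (((u + v) / 2 : ℝ) + t * I) = 1/2 + (v + t * I) := by
    push_cast; ring
  rw [e1, e2] at this
  exact Real.log_le_log (norm_pos_iff.mpr (half_ne hRH (by simpa using hu))) this

lemma F_pos (hRH : RiemannHypothesis) (z : ℂ) (hz : 0 < z.re) : 0 ≤ (F z).re := by
  have hzz : z = ((z.re : ℝ) : ℂ) + z.im * I := (Complex.re_add_im z).symm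
  have h := Lg_hasDeriv hRH z.im hz
  rw [← hzz] at h
  have h2 := (hasDerivWithinAt_iff_tendsto_slope' (s := Set.Ioi z.re) (by simp)).mp h.hasDerivWithinAt
  refine ge_of_tendsto h2 ?_
  have : Set.Ioo z.re (z.re + 1/2) ∈ nhdsWithin z.re (Set.Ioi z.re) := Ioo_mem_nhdsGT (by linarith)
  filter_upwards [this] with v hv
  rw [slope_def_field]
  exact div_nonneg (by linarith [Lg_mono hRH z.im hz hv.1 hv.2.le]) (by linarith [hv.1])

lemma F_vert (hRH : RiemannHypothesis) {u a : ℝ} (t : ℝ) (hu : 0 < u) (hua : u ≤ a) :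
    u * (F (u + t * I)).re ≤ a * (F (a + t * I)).re :=
  harnack_vert (F_diff hRH) (F_pos hRH) t hu hua

lemma Lg_upper (hRH : RiemannHypothesis) {δ a : ℝ} (t : ℝ) (hδ : 0 < δ) (hda : δ ≤ a) :
    Lg t a - Lg t δ ≤ a * (F (a + t * I)).re * (Real.log a - Real.log δ) := by
  have hm : MonotoneOn (fun u : ℝ => a * (F (a + t * I)).re * Real.log u - Lg t u) (Set.Icc δ a) := by
    have hder : ∀ u ∈ Set.Icc δ a, HasDerivAt (fun u : ℝ => a * (F (a + t * I)).re * Real.log u - Lg t u)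
        (a * (F (a + t * I)).re * u⁻¹ - (F (u + t * I)).re) u := by
      intro u hu
      have hu0 : 0 < u := by linarith [hu.1]
      exact ((Real.hasDerivAt_log hu0.ne').const_mul _).sub (Lg_hasDeriv hRH t hu0)
    apply monotoneOn_of_deriv_nonneg (convex_Icc _ _)
    · exact fun u hu => (hder u hu).continuousAt.continuousWithinAt
    · exact fun u hu => (hder u (interior_subset hu)).differentiableAt.differentiableWithinAt
    · intro u hu
      have hu := interior_subset hu
      have hu0 : 0 < u := by linarith [hu.1]
      rw [(hder u hu).deriv, sub_nonneg, ← div_eq_mul_inv, le_div_iff₀ hu0, mul_comm]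
      exact F_vert hRH t hu0 hu.2
  have := hm (Set.left_mem_Icc.mpr hda) (Set.right_mem_Icc.mpr hda) hda
  simp only at this
  linarith

lemma Lg_lower (hRH : RiemannHypothesis) {a b : ℝ} (t : ℝ) (ha : 0 < a) (hab : a ≤ b) :
    a * (F (a + t * I)).re * (Real.log b - Real.log a) ≤ Lg t b - Lg t a := by
  have hm : MonotoneOn (fun u : ℝ => Lg t u - a * (F (a + t * I)).re * Real.log u) (Set.Icc a b) := by
    have hder : ∀ u ∈ Set.Icc a b, HasDerivAt (fun u : ℝ => Lg t u - a * (F (a + t * I)).re * Real.log u)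
        ((F (u + t * I)).re - a * (F (a + t * I)).re * u⁻¹) u := by
      intro u hu
      have hu0 : 0 < u := by linarith [hu.1]
      exact (Lg_hasDeriv hRH t hu0).sub ((Real.hasDerivAt_log hu0.ne').const_mul _)
    apply monotoneOn_of_deriv_nonneg (convex_Icc _ _)
    · exact fun u hu => (hder u hu).continuousAt.continuousWithinAt
    · exact fun u hu => (hder u (interior_subset hu)).differentiableAt.differentiableWithinAt
    · intro u hu
      have hu := interior_subset hu
      have hu0 : 0 < u := by linarith [hu.1]
      rw [(hder u hu).deriv, sub_nonneg, ← div_eq_mul_inv, div_le_iff₀ hu0, mul_comm _ u]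
      exact F_vert hRH t ha hu.1
  have := hm (Set.left_mem_Icc.mpr hab) (Set.right_mem_Icc.mpr hab) hab
  simp only at this
  linarith

end CVS

namespace CVS

lemma norm_re_im (a t : ℝ) : ‖(a:ℂ) + t * I‖ ^ 2 = a ^ 2 + t ^ 2 := by
  rw [← normSq_eq_norm_sq, normSq_apply]
  simp; ring

lemma norm_xi_add_two {s : ℂ} (hs : 0 < s.re) :
    xi (s + 2) = (s + 2) * (Gammaℝ s * s / 2 / π) * riemannZeta₁ (s + 2) := by
  have h0 : s ≠ 0 := by rintro rfl; simp at hs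
  rw [xi_eq (by simp; linarith), Gammaℝ_add_two h0]

lemma P_large (hRH : RiemannHypothesis) {t : ℝ} (ht : 9/4 ≤ |t|) :
    (F ((1:ℝ) + t * I)).re * Real.log 3 ≤ Real.log (|t| + 2) := by
  have h := Lg_lower hRH (a := 1) (b := 3) t (by norm_num) (by norm_num)
  rw [Real.log_one, sub_zero, one_mul] at h
  refine h.trans ?_
  unfold Lg
  set s : ℂ := ((3/2 : ℝ) : ℂ) + t * I with hs
  have e1 : (1/2 : ℂ) + (((1:ℝ):ℂ) + t * I) = s := by rw [hs]; push_cast; ring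
  have e3 : (1/2 : ℂ) + (((3:ℝ):ℂ) + t * I) = s + 2 := by rw [hs]; push_cast; ring
  rw [e1, e3]
  have hsre : s.re = 3/2 := by rw [hs, add_re, ofReal_re]; simp
  have hx : xi s ≠ 0 := xi_ne_zero hRH (by rw [hsre]; norm_num)
  have hx2 : xi (s + 2) ≠ 0 := xi_ne_zero hRH (by simp [hsre]; norm_num)
  rw [← Real.log_div (norm_ne_zero_iff.mpr hx2) (norm_ne_zero_iff.mpr hx)]
  apply Real.log_le_log (by positivity)
  rw [div_le_iff₀ (by positivity)]
  have hs1 : s ≠ 1 := by intro h; rw [h] at hsre; norm_num at hsre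
  have hs2 : s + 2 ≠ 1 := by
    intro h; have := congrArg Complex.re h; simp [hsre] at this; norm_num at this
  rw [norm_xi_add_two (by rw [hsre]; norm_num), xi_eq (by rw [hsre]; norm_num), zeta1_eq_mul hs1,
    zeta1_eq_mul hs2]
  simp only [norm_mul, norm_div]
  have n2 : ‖(2:ℂ)‖ = 2 := by simp
  have npi : ‖(π:ℂ)‖ = π := by rw [Complex.norm_real, Real.norm_eq_abs, abs_of_pos Real.pi_pos]
  rw [n2, npi]
  have t2 : |t| ^ 2 = t ^ 2 := sq_abs t
  have b1 : ‖s + 2‖ ≤ |t| + 2 := by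
    rw [← sq_le_sq₀ (norm_nonneg _) (by positivity)]
    have : s + 2 = ((7/2 : ℝ) : ℂ) + t * I := by rw [hs]; push_cast; ring
    rw [this, norm_re_im]; nlinarith
  have b2 : ‖s + 2 - 1‖ ≤ 1.48 * ‖s - 1‖ := by
    rw [← sq_le_sq₀ (norm_nonneg _) (by positivity), mul_pow]
    have a1 : s + 2 - 1 = ((5/2 : ℝ) : ℂ) + t * I := by rw [hs]; push_cast; ring
    have a2 : s - 1 = ((1/2 : ℝ) : ℂ) + t * I := by rw [hs]; push_cast; ring
    rw [a1, a2, norm_re_im, norm_re_im]; nlinarith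
  have b3 : ‖riemannZeta (s + 2)‖ ≤ 1.4 := by
    refine (zeta_norm_le (by simp [hsre]; norm_num)).trans ?_
    have : (s + 2).re = 7/2 := by simp [hsre]; norm_num
    rw [this]; norm_num
  have hz0 : riemannZeta s ≠ 0 := riemannZeta_ne_zero_of_one_lt_re (by rw [hsre]; norm_num)
  have b4 : 1/3 ≤ ‖riemannZeta s‖ := by
    have := zeta_inv_norm_le (s := s) (by rw [hsre]; norm_num)
    rw [norm_inv, hsre, inv_le_comm₀ (norm_pos_iff.mpr hz0) (by norm_num)] at this
    norm_num at this ⊢; exact this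
  have hpi : 3.14 < π := Real.pi_gt_d2
  set g := ‖Gammaℝ s‖
  set σ := ‖s‖
  have hd : 0 ≤ ‖s - 1‖ := norm_nonneg _
  have hg : 0 ≤ g * σ := by positivity
  calc ‖s + 2‖ * (g * σ / 2 / π) * (‖s + 2 - 1‖ * ‖riemannZeta (s + 2)‖)
      ≤ (|t| + 2) * (g * σ / 2 / π) * (1.48 * ‖s - 1‖ * 1.4) := by gcongr
    _ = (|t| + 2) * (g * σ) * ‖s - 1‖ * (1.036 / π) := by ring
    _ ≤ (|t| + 2) * (g * σ) * ‖s - 1‖ * ‖riemannZeta s‖ := by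
        gcongr
        refine le_trans ?_ b4
        rw [div_le_iff₀ (by positivity)]; linarith
    _ = _ := by ring

lemma P_base (hRH : RiemannHypothesis) : (F ((3/2 : ℝ) : ℂ)).re ≤ 2/11 := by
  have h := Lg_lower hRH (a := 3/2) (b := 7/2) 0 (by norm_num) (by norm_num)
  simp only [ofReal_zero, zero_mul, add_zero] at h
  rw [← Real.log_div (by norm_num) (by norm_num)] at h
  unfold Lg at h
  have e1 : (1/2 : ℂ) + ((3/2 : ℝ) + (0:ℝ) * I) = 2 := by push_cast; ring
  have e2 : (1/2 : ℂ) + ((7/2 : ℝ) + (0:ℝ) * I) = 2 + 2 := by push_cast; ring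
  rw [e1, e2] at h
  have x2 : xi 2 ≠ 0 := xi_ne_zero hRH (by norm_num)
  have x4 : xi (2 + 2) ≠ 0 := xi_ne_zero hRH (by norm_num)
  rw [← Real.log_div (norm_ne_zero_iff.mpr x4) (norm_ne_zero_iff.mpr x2), ← norm_div] at h
  have hr : xi (2 + 2) / xi 2 = ((0.4 * π : ℝ) : ℂ) := by
    rw [norm_xi_add_two (by norm_num), xi_eq (by norm_num), zeta1_eq_mul (by norm_num),
      zeta1_eq_mul (by norm_num), riemannZeta_two, show (2 + 2 : ℂ) = 4 by norm_num, riemannZeta_four]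
    have hg := Gammaℝ_ne_zero_of_re_pos (s := 2) (by norm_num)
    have hp : (π:ℂ) ≠ 0 := by exact_mod_cast Real.pi_ne_zero
    push_cast
    field_simp
    norm_num
  rw [hr, Complex.norm_real, Real.norm_eq_abs, abs_of_pos (by positivity)] at h
  have h3 : Real.log (0.4 * π) * 11 ≤ 3 * Real.log (7/3) := by
    have : Real.log ((0.4 * π) ^ 11) ≤ Real.log ((7/3) ^ 3) := by
      apply Real.log_le_log (by positivity)
      calc (0.4 * π) ^ 11 ≤ (0.4 * 3.1416) ^ 11 := by
            gcongr
            exact Real.pi_lt_d4.le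
        _ ≤ _ := by norm_num
    rw [Real.log_pow, Real.log_pow] at this
    push_cast at this
    linarith
  rw [show (7/2 / (3/2) : ℝ) = 7/3 by norm_num] at h
  have hl : 0 < Real.log (7/3) := Real.log_pos (by norm_num)
  have : 3/2 * (F ((3/2 : ℝ) : ℂ)).re * Real.log (7/3) * 11 ≤ 3 * Real.log (7/3) := by linarith
  have h4 : 3/2 * (F ((3/2 : ℝ) : ℂ)).re * 11 ≤ 3 := by
    by_contra hc
    push Not at hc
    nlinarith
  linarith

lemma P_small (hRH : RiemannHypothesis) {t r : ℝ} (hr0 : 0 ≤ r) (hr1 : r < 1)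
    (ht : 1/4 + t ^ 2 ≤ r ^ 2 * (25/4 + t ^ 2)) :
    (F ((1:ℝ) + t * I)).re ≤ (1 + r) / (1 - r) * (2/11) := by
  have h := harnack_hp (F_diff hRH) (F_pos hRH) (c := ((3/2 : ℝ) : ℂ)) (z := (1:ℝ) + t * I)
    (by rw [ofReal_re]; norm_num) (by simp) hr1 (by
      rw [conj_ofReal, ← sq_le_sq₀ (norm_nonneg _) (by positivity), mul_pow]
      have a1 : ((1:ℝ):ℂ) + t * I - ((3/2 : ℝ) : ℂ) = ((-1/2 : ℝ) : ℂ) + t * I := by push_cast; ring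
      have a2 : ((1:ℝ):ℂ) + t * I + ((3/2 : ℝ) : ℂ) = ((5/2 : ℝ) : ℂ) + t * I := by push_cast; ring
      rw [a1, a2, norm_re_im, norm_re_im]
      linarith)
  refine h.trans ?_
  have := P_base hRH
  have h2 : 0 ≤ (1 + r) / (1 - r) := div_nonneg (by linarith) (by linarith)
  gcongr

lemma P_bound (hRH : RiemannHypothesis) (t : ℝ) :
    (F ((1:ℝ) + t * I)).re * Real.log 3 ≤ Real.log (|t| + 2) := by
  have t2 : |t| ^ 2 = t ^ 2 := sq_abs t
  have hl3 : 0 < Real.log 3 := Real.log_pos (by norm_num)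
  have ha := abs_nonneg t
  rcases le_or_gt (9/4) |t| with h | h
  · exact P_large hRH h
  rcases le_or_gt 1 |t| with h1 | h1
  · have := P_small hRH (t := t) (r := 0.686) (by norm_num) (by norm_num) (by nlinarith)
    have h5 : (F ((1:ℝ) + t * I)).re ≤ 1 := this.trans (by norm_num)
    have : Real.log 3 ≤ Real.log (|t| + 2) := Real.log_le_log (by norm_num) (by linarith)
    nlinarith
  · have := P_small hRH (t := t) (r := 0.42) (by norm_num) (by norm_num) (by nlinarith)
    have h5 : (F ((1:ℝ) + t * I)).re ≤ 1/2 := this.trans (by norm_num)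
    have h6 : Real.log 3 ≤ Real.log (2 ^ 2) := Real.log_le_log (by norm_num) (by norm_num)
    rw [Real.log_pow] at h6
    push_cast at h6
    have : Real.log 2 ≤ Real.log (|t| + 2) := Real.log_le_log (by norm_num) (by linarith)
    nlinarith

end CVS

namespace CVS

lemma zeta_lower (hRH : RiemannHypothesis) : ∃ C : ℝ, 0 < C ∧ ∀ δ : ℝ, 0 < δ → δ ≤ 1/4 → ∀ t : ℝ,
    riemannZeta ((1/2 + δ : ℝ) + t * I) ≠ 0 ∧
    ‖(riemannZeta ((1/2 + δ : ℝ) + t * I))⁻¹‖ ≤ C * (|t| + 2) ^ (-Real.log δ) := by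
  obtain ⟨K, hK, hKr⟩ := gammaR_ratio (s0 := 1/2) (b0 := 3/4) (by norm_num) (by norm_num)
  refine ⟨3 * K, by positivity, fun δ hδ hδ4 t => ?_⟩
  set s : ℂ := ((1/2 + δ : ℝ) : ℂ) + t * I with hs
  set s1 : ℂ := s + ((1 - δ : ℝ) : ℂ) with hs1
  have hsre : s.re = 1/2 + δ := by rw [hs, add_re, ofReal_re]; simp
  have hs1re : s1.re = 3/2 := by rw [hs1, add_re, ofReal_re, hsre]; ring
  have hne1 : s ≠ 1 := by intro h; rw [h, one_re] at hsre; linarith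
  have hne1' : s1 ≠ 1 := by intro h; rw [h, one_re] at hs1re; norm_num at hs1re
  have hx : xi s ≠ 0 := xi_ne_zero hRH (by rw [hsre]; linarith)
  have hx1 : xi s1 ≠ 0 := xi_ne_zero hRH (by rw [hs1re]; norm_num)
  have hz1 := zeta1_ne_zero hRH (s := s) (by rw [hsre]; linarith)
  rw [zeta1_eq_mul hne1] at hz1
  have hz : riemannZeta s ≠ 0 := right_ne_zero_of_mul hz1
  refine ⟨hz, ?_⟩
  have hU := Lg_upper hRH (a := 1) t hδ (by linarith)
  rw [Real.log_one, zero_sub, one_mul] at hU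
  unfold Lg at hU
  have e1 : (1/2 : ℂ) + (((1:ℝ):ℂ) + t * I) = s1 := by rw [hs1, hs]; push_cast; ring
  have e2 : (1/2 : ℂ) + ((δ:ℂ) + t * I) = s := by rw [hs]; push_cast; ring
  rw [e1, e2] at hU
  set E := (|t| + 2) ^ (-Real.log δ) with hE
  have ht : 0 < |t| + 2 := by positivity
  have hlδ : 0 ≤ -Real.log δ := by
    have := Real.log_nonpos hδ.le (by linarith); linarith
  have hP : (F ((1:ℝ) + t * I)).re ≤ Real.log (|t| + 2) := by
    have h1 := P_bound hRH t
    have h2 := F_pos hRH ((1:ℝ) + t * I) (by simp)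
    have h3 : 1 ≤ Real.log 3 := by
      rw [Real.le_log_iff_exp_le (by norm_num)]
      linarith [Real.exp_one_lt_d9]
    nlinarith
  have hU2 : Real.log ‖xi s1‖ ≤ Real.log (‖xi s‖ * E) := by
    have hEpos : 0 < E := by positivity
    rw [Real.log_mul (norm_ne_zero_iff.mpr hx) hEpos.ne', hE, Real.log_rpow ht]
    have := mul_le_mul_of_nonneg_right hP hlδ
    linarith
  have hEpos : 0 < E := by positivity
  have hU3 : ‖xi s1‖ ≤ ‖xi s‖ * E := by
    have := norm_pos_iff.mpr hx
    exact (Real.log_le_log_iff (norm_pos_iff.mpr hx1) (by positivity)).mp hU2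
  rw [xi_eq (s := s) (by rw [hsre]; linarith), xi_eq (s := s1) (by rw [hs1re]; norm_num), zeta1_eq_mul hne1,
    zeta1_eq_mul hne1'] at hU3
  simp only [norm_mul] at hU3
  have hG := hKr s (1 - δ) (by rw [hsre]; linarith) (by linarith) (by linarith)
  rw [← hs1] at hG
  have hz1' : riemannZeta s1 ≠ 0 := riemannZeta_ne_zero_of_one_lt_re (by rw [hs1re]; norm_num)
  have b4 : 1/3 ≤ ‖riemannZeta s1‖ := by
    have := zeta_inv_norm_le (s := s1) (by rw [hs1re]; norm_num)
    rw [norm_inv, hs1re, inv_le_comm₀ (norm_pos_iff.mpr hz1') (by norm_num)] at this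
    norm_num at this ⊢; exact this
  have b5 : ‖s - 1‖ ≤ ‖s1 - 1‖ := by
    rw [← sq_le_sq₀ (norm_nonneg _) (by positivity)]
    have a1 : s - 1 = ((δ - 1/2 : ℝ) : ℂ) + t * I := by rw [hs]; push_cast; ring
    have a2 : s1 - 1 = ((1/2 : ℝ) : ℂ) + t * I := by rw [hs1, hs]; push_cast; ring
    rw [a1, a2, norm_re_im, norm_re_im]; nlinarith
  set A := ‖s1‖ * ‖Gammaℝ s1‖ with hA
  have hA0 : 0 < A := by
    have h0 : s1 ≠ 0 := by intro h; rw [h, zero_re] at hs1re; norm_num at hs1re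
    exact mul_pos (norm_pos_iff.mpr h0)
      (norm_pos_iff.mpr (Gammaℝ_ne_zero_of_re_pos (by rw [hs1re]; norm_num)))
  have hB0 : 0 < ‖s1 - 1‖ := norm_pos_iff.mpr (sub_ne_zero.mpr hne1')
  have h6 : A * ‖s1 - 1‖ * (1/3) ≤ A * ‖s1 - 1‖ * (K * ‖riemannZeta s‖ * E) := by
    calc A * ‖s1 - 1‖ * (1/3) ≤ A * ‖s1 - 1‖ * ‖riemannZeta s1‖ := by gcongr
      _ = A * (‖s1 - 1‖ * ‖riemannZeta s1‖) := by ring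
      _ ≤ _ := hU3
      _ ≤ K * A * (‖s1 - 1‖ * ‖riemannZeta s‖) * E := by gcongr
      _ = _ := by ring
  have h7 := le_of_mul_le_mul_left h6 (by positivity)
  have hzp := norm_pos_iff.mpr hz
  rw [norm_inv, inv_le_iff_one_le_mul₀ hzp]
  nlinarith

lemma pow_aux {Y X L : ℝ} (hY : 1 ≤ Y) (hX0 : 0 ≤ X) (hX : X ≤ Real.exp Y) (hL : L = Real.log (Y ^ 2)) :
    (X + 2) ^ L ≤ Real.exp 4 * Real.exp (Y * L) := by
  have hL0 : 0 ≤ L := by rw [hL]; exact Real.log_nonneg (by nlinarith)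
  have hLY : L ≤ 2 * Real.exp Y := by
    rw [hL, Real.log_pow]
    have := Real.log_le_self (by linarith : 0 ≤ Y)
    have := Real.add_one_le_exp Y
    push_cast; linarith
  have hexp : 0 < Real.exp Y := Real.exp_pos Y
  have h1 : X + 2 ≤ Real.exp (Y + 2 * Real.exp (-Y)) := by
    rw [Real.exp_add]
    have h2 := Real.add_one_le_exp (2 * Real.exp (-Y))
    have h3 : Real.exp Y * Real.exp (-Y) = 1 := by rw [← Real.exp_add]; simp
    nlinarith
  calc (X + 2) ^ L ≤ (Real.exp (Y + 2 * Real.exp (-Y))) ^ L := by gcongr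
    _ = Real.exp (2 * Real.exp (-Y) * L + Y * L) := by rw [← Real.exp_mul]; congr 1; ring
    _ ≤ Real.exp (4 + Y * L) := by
        apply Real.exp_le_exp.mpr
        have h3 : Real.exp (-Y) * Real.exp Y = 1 := by rw [← Real.exp_add]; simp
        have := mul_le_mul_of_nonneg_left hLY (Real.exp_pos (-Y)).le
        nlinarith
    _ = _ := Real.exp_add _ _

end CVS


/-- Equation (10).  Assume RH.  Then `|1/ζ(1/2 + 1/log x + it)| ≪ (|t|+2)^{log log x}` for
large `x`, and hence the integral of `x^s/(sζ(s))` over the vertical segment from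
`1/2 + 1/log x − ix₀` to `1/2 + 1/log x + ix₀` with `x₀ = ⌊exp(√(log x))⌋` is
`≪ x^{1/2} exp((log x)^{1/2} log log x)`. -/
theorem central_vertical_segment_bound (hRH : RiemannHypothesis) :
    ∃ C > (0:ℝ), ∃ x₀ : ℝ, ∀ x ≥ x₀,
      (∀ t : ℝ,
        ‖(riemannZeta ((1/2 + 1/Real.log x : ℝ) + t * Complex.I))⁻¹‖ ≤
          C * (|t| + 2) ^ (Real.log (Real.log x))) ∧
      ‖∫ y in (-(⌊Real.exp (Real.sqrt (Real.log x))⌋₊ : ℝ))..(⌊Real.exp (Real.sqrt (Real.log x))⌋₊ : ℝ),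
          (x : ℂ) ^ (((1/2 + 1/Real.log x : ℝ) : ℂ) + y * Complex.I) /
            ((((1/2 + 1/Real.log x : ℝ) : ℂ) + y * Complex.I) *
              riemannZeta (((1/2 + 1/Real.log x : ℝ) : ℂ) + y * Complex.I)) * Complex.I‖ ≤
        C * Real.sqrt x * Real.exp (Real.sqrt (Real.log x) * Real.log (Real.log x)) := by
  obtain ⟨C, hC, hCb⟩ := CVS.zeta_lower hRH
  refine ⟨10 * Real.exp 5 * C, by positivity, Real.exp 4, fun x hx => ?_⟩
  have hx0 : 0 < x := lt_of_lt_of_le (Real.exp_pos 4) hx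
  have hlx : 4 ≤ Real.log x := (Real.le_log_iff_exp_le hx0).mpr hx
  have hlx0 : 0 < Real.log x := by linarith
  have hδ : 0 < 1 / Real.log x := by positivity
  have hδ4 : 1 / Real.log x ≤ 1/4 := one_div_le_one_div_of_le (by norm_num) hlx
  have hlog : -Real.log (1 / Real.log x) = Real.log (Real.log x) := by
    rw [one_div, Real.log_inv, neg_neg]
  have hmain := hCb _ hδ hδ4
  rw [hlog] at hmain
  set L := Real.log (Real.log x) with hLdef
  have hL1 : 1 ≤ L := by
    rw [hLdef, Real.le_log_iff_exp_le hlx0]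
    linarith [Real.exp_one_lt_d9]
  have hbig : C ≤ 10 * Real.exp 5 * C := by
    have : 1 ≤ Real.exp 5 := Real.one_le_exp (by norm_num)
    nlinarith
  refine ⟨fun t => (hmain t).2.trans (by gcongr), ?_⟩
  set Y := Real.sqrt (Real.log x) with hY
  have hYsq : Y ^ 2 = Real.log x := Real.sq_sqrt hlx0.le
  have hY1 : 1 ≤ Y := by rw [hY, Real.le_sqrt (by norm_num) hlx0.le]; linarith
  set X : ℝ := (⌊Real.exp Y⌋₊ : ℝ) with hX
  have hX0 : 0 ≤ X := Nat.cast_nonneg _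
  have hXe : X ≤ Real.exp Y := Nat.floor_le (Real.exp_pos _).le
  have hpw := CVS.pow_aux hY1 hX0 hXe (L := L) (by rw [hYsq])
  have hbd : ∀ y ∈ Set.uIoc (-X) X, ‖(x : ℂ) ^ (((1/2 + 1/Real.log x : ℝ) : ℂ) + y * Complex.I) /
            ((((1/2 + 1/Real.log x : ℝ) : ℂ) + y * Complex.I) *
              riemannZeta (((1/2 + 1/Real.log x : ℝ) : ℂ) + y * Complex.I)) * Complex.I‖ ≤
      5 * Real.exp 1 * C * Real.sqrt x * (X + 2) ^ (L - 1) := by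
    intro y hy
    rw [Set.uIoc_of_le (by linarith)] at hy
    have hyX : |y| ≤ X := abs_le.mpr ⟨hy.1.le, hy.2⟩
    have hm := (hmain y).2
    set s : ℂ := ((1/2 + 1/Real.log x : ℝ) : ℂ) + y * Complex.I with hs
    have hsre : s.re = 1/2 + 1/Real.log x := by rw [hs, add_re, ofReal_re]; simp
    have hsim : s.im = y := by rw [hs, add_im, ofReal_im]; simp
    have hn1 : |y| ≤ ‖s‖ := by rw [← hsim]; exact Complex.abs_im_le_norm s
    have hn2 : 1/2 ≤ ‖s‖ := by
      refine le_trans ?_ (Complex.re_le_norm s)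
      rw [hsre]; linarith
    have hn3 : ‖s‖⁻¹ ≤ 5 * (|y| + 2)⁻¹ := by
      have : (|y| + 2) / 5 ≤ ‖s‖ := by linarith
      calc ‖s‖⁻¹ ≤ ((|y| + 2) / 5)⁻¹ := inv_anti₀ (by positivity) this
        _ = _ := by rw [inv_div]; rfl
    have hxp : ‖(x:ℂ) ^ s‖ = Real.exp 1 * Real.sqrt x := by
      rw [norm_cpow_eq_rpow_re_of_pos hx0, hsre, Real.rpow_add hx0, ← Real.sqrt_eq_rpow, mul_comm]
      congr 1
      rw [Real.rpow_def_of_pos hx0]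
      congr 1
      field_simp
    have hpos : 0 < |y| + 2 := by positivity
    rw [norm_mul, Complex.norm_I, mul_one, norm_div, norm_mul, hxp, div_eq_mul_inv, mul_inv,
      ← norm_inv (riemannZeta s)]
    calc Real.exp 1 * Real.sqrt x * (‖s‖⁻¹ * ‖(riemannZeta s)⁻¹‖)
        ≤ Real.exp 1 * Real.sqrt x * (5 * (|y| + 2)⁻¹ * (C * (|y| + 2) ^ L)) := by gcongr
      _ = 5 * Real.exp 1 * C * Real.sqrt x * (|y| + 2) ^ (L - 1) := by
          rw [Real.rpow_sub_one hpos.ne']; ring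
      _ ≤ _ := by
          gcongr
  have hfin := intervalIntegral.norm_integral_le_of_norm_le_const hbd
  refine hfin.trans ?_
  have hpos : 0 < X + 2 := by linarith
  have hXX : |X - -X| ≤ 2 * (X + 2) := by
    rw [abs_of_nonneg (by linarith)]; linarith
  calc _ ≤ 5 * Real.exp 1 * C * Real.sqrt x * (X + 2) ^ (L - 1) * (2 * (X + 2)) := by gcongr
    _ = 10 * Real.exp 1 * C * Real.sqrt x * (X + 2) ^ L := by
        rw [Real.rpow_sub_one hpos.ne']
        field_simp
        ring
    _ ≤ 10 * Real.exp 1 * C * Real.sqrt x * (Real.exp 4 * Real.exp (Y * L)) := by gcongr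
    _ = _ := by
        rw [show (5:ℝ) = 1 + 4 by norm_num, Real.exp_add]; ring
end
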